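/- (Projection theorem) Let X be a Polish space, Y a compact Polish space, E a semi-stable cone of functions on Y, and let C : X × P(Y) → [0,∞] be lower semicontinuous and convex in its second argument. Then for all μ ∈ P(X) and ν ∈ P(Y): inf_{η ≼_E ν} inf_{π ∈ Π(μ,η)} ∫_X C(x,π_x) dμ(x) = inf_{π ∈ Π(μ,ν)} ∫_X ( inf_{ξ ≼_E π_x} C(x,ξ) ) dμ(x) = sup_{ψ ∈ E} ( ∫_X ψ^C dμ − ∫_Y ψ dν ). -/

import Mathlib

open MeasureTheory Set Filter Topology
open scoped ENNReal

noncomputable section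

/-- The order induced by a set `E` of (integrable) functions:
`ρ₁ ≼_E ρ₂` iff `∫ f dρ₁ ≤ ∫ f dρ₂` for all `f ∈ E`. -/
def EOrder {Y : Type*} [MeasurableSpace Y] (E : Set (Y → ℝ)) (ρ₁ ρ₂ : Measure Y) : Prop :=
  ∀ f ∈ E, ∫ y, f y ∂ρ₁ ≤ ∫ y, f y ∂ρ₂

/-- A semi-stable cone of functions on `Y`: a set of bounded lower semicontinuous
real-valued functions containing the constants, closed under conic combinations and under
pointwise suprema that remain bounded and lower semicontinuous, and whose members are
pointwise suprema of continuous members. -/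
structure SemiStableCone (Y : Type*) [TopologicalSpace Y] where
  carrier : Set (Y → ℝ)
  subset_lsc_bdd : ∀ f ∈ carrier, LowerSemicontinuous f ∧ ∃ M : ℝ, ∀ y, |f y| ≤ M
  const_mem : ∀ c : ℝ, (fun _ => c) ∈ carrier
  add_mem : ∀ f ∈ carrier, ∀ g ∈ carrier, (fun y => f y + g y) ∈ carrier
  smul_mem : ∀ c : ℝ, 0 ≤ c → ∀ f ∈ carrier, (fun y => c * f y) ∈ carrier
  sup_mem : ∀ S : Set (Y → ℝ), S ⊆ carrier → S.Nonempty →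
    (∀ y, BddAbove ((fun f : Y → ℝ => f y) '' S)) →
    (LowerSemicontinuous (fun y => ⨆ f : S, f.1 y) ∧
      ∃ M : ℝ, ∀ y, |⨆ f : S, f.1 y| ≤ M) →
    (fun y => ⨆ f : S, f.1 y) ∈ carrier
  sup_continuous : ∀ f ∈ carrier, ∃ S : Set (Y → ℝ), S ⊆ carrier ∧ S.Nonempty ∧
    (∀ g ∈ S, Continuous g) ∧ (∀ y, BddAbove ((fun g : Y → ℝ => g y) '' S)) ∧
    ∀ y, f y = ⨆ g : S, g.1 y

/-- `π` is a coupling of `μ` and `ν`. -/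
def IsCoupling {X Y : Type*} [MeasurableSpace X] [MeasurableSpace Y]
    (π : Measure (X × Y)) (μ : Measure X) (ν : Measure Y) : Prop :=
  IsProbabilityMeasure π ∧ π.map Prod.fst = μ ∧ π.map Prod.snd = ν

open scoped Classical in
/-- Disintegration of a measure on a product space with respect to its first marginal. -/
def disint {X : Type*} [MeasurableSpace X] {Y : Type*} [MeasurableSpace Y]
    [StandardBorelSpace Y] [Nonempty Y] (π : Measure (X × Y)) :
    ProbabilityTheory.Kernel X Y :=
  if h : IsFiniteMeasure π then (haveI := h; π.condKernel) else 0

end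

noncomputable section

open scoped Classical in
/-- The nonnegative part of an extended real, as an extended nonnegative real. -/
def erealToENN (x : EReal) : ℝ≥0∞ := if x = ⊤ then ⊤ else ENNReal.ofReal x.toReal

/-- Canonical extended integral of an `EReal`-valued function. -/
def eInt {α : Type*} [MeasurableSpace α] (μ : Measure α) (f : α → EReal) : EReal :=
  ((∫⁻ x, erealToENN (f x) ∂μ : ℝ≥0∞) : EReal) -
    ((∫⁻ x, erealToENN (-(f x)) ∂μ : ℝ≥0∞) : EReal)

/-- The `C`-conjugate `ψ^C (x) = inf_{ρ ∈ P(Y)} ρ(ψ) + C(x, ρ)`. -/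
def conjP {X : Type*} [MeasurableSpace X] {Y : Type*} [MeasurableSpace Y]
    (C : X → Measure Y → ℝ≥0∞) (ψ : Y → ℝ) (x : X) : EReal :=
  ⨅ ρ : {ρ : Measure Y // IsProbabilityMeasure ρ},
    ((∫ y, ψ y ∂ρ.1 : ℝ) : EReal) + ((C x ρ.1 : ℝ≥0∞) : EReal)

end

noncomputable section

namespace WeakTransport

section Mix

variable {Y : Type*} [MeasurableSpace Y]

/-- The convex combination `t ρ + (1 - t) ρ'` of two probability measures. -/
def mix (t : ℝ≥0∞) (ht : t ≤ 1) (ρ ρ' : ProbabilityMeasure Y) : ProbabilityMeasure Y :=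
  ⟨t • (ρ : Measure Y) + (1 - t) • (ρ' : Measure Y), ⟨by simp [add_tsub_cancel_of_le ht]⟩⟩

lemma integral_mix {t : ℝ≥0∞} (ht : t ≤ 1) (ρ ρ' : ProbabilityMeasure Y) {f : Y → ℝ}
    (hf : Integrable f (ρ : Measure Y)) (hf' : Integrable f (ρ' : Measure Y)) :
    ∫ y, f y ∂(mix t ht ρ ρ' : Measure Y) =
      t.toReal * ∫ y, f y ∂(ρ : Measure Y) + (1 - t.toReal) * ∫ y, f y ∂(ρ' : Measure Y) := by
  have h1 : (1 - t).toReal = 1 - t.toReal := by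
    rw [ENNReal.toReal_sub_of_le ht ENNReal.one_ne_top, ENNReal.toReal_one]
  change ∫ y, f y ∂(t • (ρ : Measure Y) + (1 - t) • (ρ' : Measure Y)) = _
  rw [integral_add_measure (hf.smul_measure (ne_top_of_le_ne_top ENNReal.one_ne_top ht))
    (hf'.smul_measure (ne_top_of_le_ne_top ENNReal.one_ne_top tsub_le_self)),
    integral_smul_measure, integral_smul_measure, h1, smul_eq_mul, smul_eq_mul]

end Mix

section CompactMetric

variable {Y : Type*} [MetricSpace Y] [CompactSpace Y] [MeasurableSpace Y] [BorelSpace Y]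

lemma integrable_continuousMap (f : C(Y, ℝ)) (ρ : Measure Y) [IsFiniteMeasure ρ] :
    Integrable f ρ :=
  f.continuous.integrable_of_hasCompactSupport (HasCompactSupport.of_compactSpace f)

lemma abs_integral_continuousMap_le {Y : Type*} [TopologicalSpace Y] [CompactSpace Y]
    [MeasurableSpace Y] (f : C(Y, ℝ)) (ρ : Measure Y) [IsProbabilityMeasure ρ] :
    |∫ y, f y ∂ρ| ≤ ‖f‖ := by
  have := norm_integral_le_of_norm_le_const (μ := ρ) (f := f) (C := ‖f‖)
    (ae_of_all _ f.norm_coe_le_norm)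
  simpa using this

lemma continuous_integral_left (ρ : Measure Y) [IsProbabilityMeasure ρ] :
    Continuous fun f : C(Y, ℝ) => ∫ y, f y ∂ρ := by
  refine LipschitzWith.continuous (K := 1) (LipschitzWith.of_dist_le_mul fun f g => ?_)
  rw [NNReal.coe_one, one_mul, Real.dist_eq, dist_eq_norm,
    ← integral_sub (integrable_continuousMap f ρ) (integrable_continuousMap g ρ)]
  exact abs_integral_continuousMap_le (f - g) ρ

/-- The integrals of a fixed dense sequence of continuous functions. -/
def moments (ρ : ProbabilityMeasure Y) (j : ℕ) : ℝ :=
  ∫ y, TopologicalSpace.denseSeq C(Y, ℝ) j y ∂(ρ : Measure Y)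

lemma continuous_moments : Continuous (moments (Y := Y)) :=
  continuous_pi fun _ => ProbabilityMeasure.continuous_integral_continuousMap _

lemma injective_moments : Function.Injective (moments (Y := Y)) := by
  intro ρ ρ' h
  apply ProbabilityMeasure.toMeasure_injective
  apply ext_of_forall_integral_eq_of_IsFiniteMeasure
  intro f
  have hcl : IsClosed {f : C(Y, ℝ) | ∫ y, f y ∂(ρ : Measure Y) = ∫ y, f y ∂(ρ' : Measure Y)} :=
    isClosed_eq (continuous_integral_left _) (continuous_integral_left _)
  exact (TopologicalSpace.denseRange_denseSeq C(Y, ℝ)).induction_on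
    (p := fun f : C(Y, ℝ) => ∫ y, f y ∂(ρ : Measure Y) = ∫ y, f y ∂(ρ' : Measure Y))
    f.toContinuousMap hcl fun j => congrFun h j

lemma isClosedEmbedding_moments : IsClosedEmbedding (moments (Y := Y)) :=
  continuous_moments.isClosedEmbedding injective_moments

instance : SecondCountableTopology (ProbabilityMeasure Y) :=
  isClosedEmbedding_moments.isEmbedding.secondCountableTopology

lemma measurable_moments : Measurable (moments (Y := Y)) := by
  refine measurable_pi_lambda _ fun j => ?_
  exact (StronglyMeasurable.integral_kernel (κ := ⟨fun ρ : ProbabilityMeasure Y => (ρ : Measure Y),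
    measurable_subtype_coe⟩)
    (TopologicalSpace.denseSeq C(Y, ℝ) j).continuous.measurable.stronglyMeasurable).measurable

instance : BorelSpace (ProbabilityMeasure Y) where
  measurable_eq := by
    apply le_antisymm
    · rintro _ ⟨s, hs, rfl⟩
      have : @Measurable _ _ (borel (ProbabilityMeasure Y)) _
          (fun ρ : ProbabilityMeasure Y => (ρ : Measure Y)) := by
        let : MeasurableSpace (ProbabilityMeasure Y) := borel _
        have : BorelSpace (ProbabilityMeasure Y) := ⟨rfl⟩
        refine Measurable.measure_of_isPiSystem_of_isProbabilityMeasure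
          (BorelSpace.measurable_eq (α := Y)) isPiSystem_isOpen fun U hU => ?_
        refine LowerSemicontinuous.measurable ?_
        intro ρ a ha
        exact Filter.eventually_lt_of_lt_liminf
          (ha.trans_le (ProbabilityMeasure.le_liminf_measure_open_of_tendsto tendsto_id hU))
      exact this hs
    · refine MeasurableSpace.generateFrom_le fun U hU => ?_
      obtain ⟨V, hV, rfl⟩ := isClosedEmbedding_moments.isInducing.isOpen_iff.1 hU
      exact measurable_moments hV.measurableSet

lemma continuous_mix {t : ℝ≥0∞} (ht : t ≤ 1) :
    Continuous fun q : ProbabilityMeasure Y × ProbabilityMeasure Y => mix t ht q.1 q.2 := by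
  refine isClosedEmbedding_moments.isInducing.continuous_iff.2 (continuous_pi fun j => ?_)
  have h (q : ProbabilityMeasure Y × ProbabilityMeasure Y) : moments (mix t ht q.1 q.2) j =
      t.toReal * moments q.1 j + (1 - t.toReal) * moments q.2 j :=
    integral_mix ht q.1 q.2 (integrable_continuousMap _ _) (integrable_continuousMap _ _)
  have hm : Continuous fun ρ : ProbabilityMeasure Y => moments ρ j :=
    ProbabilityMeasure.continuous_integral_continuousMap _
  simp only [Function.comp_def, h]
  fun_prop

lemma exists_strictlyConvex (Y : Type*) [MetricSpace Y] [CompactSpace Y] [MeasurableSpace Y]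
    [BorelSpace Y] : ∃ q : ProbabilityMeasure Y → ℝ, Continuous q ∧
      ∀ t : ℝ≥0∞, ∀ ht : t ≤ 1, t = 2⁻¹ → ∀ ρ ρ',
        q (mix t ht ρ ρ') ≤ (q ρ + q ρ') / 2 ∧
        (q (mix t ht ρ ρ') = (q ρ + q ρ') / 2 → ρ = ρ') := by
  let w : ℕ → ℝ := fun j => (1 / 2) ^ j / (1 + ‖TopologicalSpace.denseSeq C(Y, ℝ) j‖) ^ 2
  have hw (j) : 0 < w j := by positivity
  have hb (j) (ρ : ProbabilityMeasure Y) : ‖w j * moments ρ j ^ 2‖ ≤ (1 / 2) ^ j := by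
    have h1 := abs_integral_continuousMap_le (TopologicalSpace.denseSeq C(Y, ℝ) j) (ρ : Measure Y)
    have h2 : moments ρ j ^ 2 ≤ (1 + ‖TopologicalSpace.denseSeq C(Y, ℝ) j‖) ^ 2 := by
      rw [← sq_abs]
      gcongr
      exact h1.trans (by linarith)
    rw [Real.norm_of_nonneg (by have := hw j; positivity)]
    simp only [w]
    rw [div_mul_eq_mul_div, div_le_iff₀ (by positivity)]
    gcongr
  have hs : Summable fun j : ℕ => ((1 : ℝ) / 2) ^ j := summable_geometric_two
  have hsum (ρ : ProbabilityMeasure Y) : Summable fun j => w j * moments ρ j ^ 2 :=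
    Summable.of_norm_bounded hs fun j => hb j ρ
  refine ⟨fun ρ => ∑' j, w j * moments ρ j ^ 2, continuous_tsum (fun j => ?_) hs hb, ?_⟩
  · have : Continuous fun ρ : ProbabilityMeasure Y => moments ρ j :=
      ProbabilityMeasure.continuous_integral_continuousMap _
    fun_prop
  · rintro t ht rfl ρ ρ'
    have hm (j) : moments (mix 2⁻¹ ht ρ ρ') j = (moments ρ j + moments ρ' j) / 2 := by
      have := integral_mix ht ρ ρ'
        (integrable_continuousMap (TopologicalSpace.denseSeq C(Y, ℝ) j) _)
        (integrable_continuousMap (TopologicalSpace.denseSeq C(Y, ℝ) j) _)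
      rw [ENNReal.toReal_inv, ENNReal.toReal_ofNat] at this
      change _ = 2⁻¹ * moments ρ j + (1 - 2⁻¹) * moments ρ' j at this
      rw [moments, this]
      ring
    have key : (∑' j, w j * moments ρ j ^ 2 + ∑' j, w j * moments ρ' j ^ 2) / 2 =
        ∑' j, (w j * moments ρ j ^ 2 + w j * moments ρ' j ^ 2) / 2 := by
      rw [tsum_div_const, (hsum ρ).tsum_add (hsum ρ')]
    have hsum' := ((hsum ρ).add (hsum ρ')).div_const 2
    have hle (j) : w j * moments (mix 2⁻¹ ht ρ ρ') j ^ 2 ≤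
        (w j * moments ρ j ^ 2 + w j * moments ρ' j ^ 2) / 2 := by
      rw [hm j]
      nlinarith [mul_nonneg (hw j).le (sq_nonneg (moments ρ j - moments ρ' j))]
    rw [key]
    refine ⟨(hsum _).tsum_le_tsum hle hsum', fun heq => ?_⟩
    apply injective_moments
    by_contra hne
    obtain ⟨j, hj⟩ := Function.ne_iff.1 hne
    refine (Summable.tsum_lt_tsum_of_nonneg (i := j) (fun j => ?_) hle ?_ hsum').ne heq
    · have := hw j
      positivity
    · rw [hm j]
      have : 0 < (moments ρ j - moments ρ' j) ^ 2 := by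
        have := sub_ne_zero.2 hj
        positivity
      nlinarith [mul_pos (hw j) this]

end CompactMetric

section Selection

variable {X Z : Type*} [MeasurableSpace X] [TopologicalSpace Z]

/-- A nonempty closed-valued multifunction whose hitting sets of closed sets are measurable. -/
structure MeasurableMultifunction (G : X → Set Z) : Prop where
  isClosed : ∀ x, IsClosed (G x)
  nonempty : ∀ x, (G x).Nonempty
  measurableSet_hit : ∀ K : Set Z, IsClosed K → MeasurableSet {x | (G x ∩ K).Nonempty}

/-- The minimisers of `h x` on `G x`. -/
def argminOn (G : X → Set Z) (h : X → Z → ℝ≥0∞) (x : X) : Set Z :=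
  {z | z ∈ G x ∧ ∀ w ∈ G x, h x z ≤ h x w}

variable [CompactSpace Z]

lemma MeasurableMultifunction.argminOn {G : X → Set Z} (hG : MeasurableMultifunction G)
    {h : X → Z → ℝ≥0∞} (hlsc : ∀ x, LowerSemicontinuous (h x))
    (hmeas : ∀ K : Set Z, IsClosed K → ∀ q : ℝ≥0∞, MeasurableSet {x | ∃ z ∈ G x ∩ K, h x z ≤ q}) :
    MeasurableMultifunction (argminOn G h) where
  isClosed x := by
    have : WeakTransport.argminOn G h x = G x ∩ ⋂ w ∈ G x, {z | h x z ≤ h x w} := by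
      ext z
      simp [WeakTransport.argminOn]
    rw [this]
    refine (hG.isClosed x).inter (isClosed_biInter fun w _ => ?_)
    exact (hlsc x).isClosed_preimage _
  nonempty x := by
    obtain ⟨z, hz, hmin⟩ := (hlsc x).lowerSemicontinuousOn (G x) |>.exists_isMinOn
      (hG.nonempty x) (hG.isClosed x).isCompact
    exact ⟨z, hz, hmin⟩
  measurableSet_hit K hK := by
    have : {x | (WeakTransport.argminOn G h x ∩ K).Nonempty} =
        {x | (G x ∩ K).Nonempty} ∩ ⋂ q : ℚ, ({x | ∃ z ∈ G x ∩ univ, h x z ≤ ENNReal.ofReal q}ᶜ ∪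
          {x | ∃ z ∈ G x ∩ K, h x z ≤ ENNReal.ofReal q}) := by
      ext x
      simp only [mem_inter_iff, mem_iInter, mem_union, mem_compl_iff, mem_ofPred_eq, mem_univ,
        and_true]
      constructor
      · rintro ⟨z, ⟨hz, hmin⟩, hzK⟩
        refine ⟨⟨z, hz, hzK⟩, fun q => or_iff_not_imp_left.2 fun hq => ?_⟩
        obtain ⟨w, hw, hwq⟩ := not_not.1 hq
        exact ⟨z, ⟨hz, hzK⟩, (hmin w hw).trans hwq⟩
      · rintro ⟨hne, hq⟩
        obtain ⟨z, hz, hmin⟩ := (hlsc x).lowerSemicontinuousOn (G x ∩ K) |>.exists_isMinOn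
          hne ((hG.isClosed x).inter hK).isCompact
        refine ⟨z, ⟨hz.1, fun w hw => ?_⟩, hz.2⟩
        by_contra! hlt
        obtain ⟨q, -, h1, h2⟩ := ENNReal.lt_iff_exists_rat_btwn.1 hlt
        rcases hq q with h3 | ⟨z', hz', h3⟩
        · exact h3 ⟨w, hw, h1.le⟩
        · exact absurd (h2.trans_le (hmin hz')) (not_lt.2 h3)
    rw [this]
    exact (hG.measurableSet_hit K hK).inter <| MeasurableSet.iInter fun q =>
      (hmeas univ isClosed_univ _).compl.union (hmeas K hK _)

lemma MeasurableMultifunction.exists_selection [TopologicalSpace.MetrizableSpace Z]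
    [MeasurableSpace Z] [BorelSpace Z] {G : X → Set Z} (hG : MeasurableMultifunction G) :
    ∃ s : X → Z, Measurable s ∧ ∀ x, s x ∈ G x := by
  let := TopologicalSpace.metrizableSpaceMetric Z
  rcases isEmpty_or_nonempty X with hX | ⟨⟨x₀⟩⟩
  · exact ⟨fun x => (hX.false x).elim, measurable_of_empty _, fun x => (hX.false x).elim⟩
  have : Nonempty Z := ⟨(hG.nonempty x₀).some⟩
  let f : ℕ → Z → ℝ≥0∞ := fun n z => edist z (TopologicalSpace.denseSeq Z n)
  have hf (n) : Continuous (f n) := continuous_id.edist continuous_const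
  let H : ℕ → X → Set Z := fun n => Nat.rec G (fun n G' => WeakTransport.argminOn G' fun _ => f n) n
  have hH (n) : MeasurableMultifunction (H n) := by
    induction n with
    | zero => exact hG
    | succ n ih =>
      refine ih.argminOn (fun x => (hf n).lowerSemicontinuous) fun K hK q => ?_
      have := ih.measurableSet_hit (K ∩ {z | f n z ≤ q})
        (hK.inter (isClosed_le (hf n) continuous_const))
      convert! this using 2
      ext x
      simp [Set.Nonempty, and_assoc]
  have hsub (n x) : H (n + 1) x ⊆ H n x := fun z hz => hz.1
  have hinter (K : Set Z) (hK : IsClosed K) (x) (hx : ∀ n, (H n x ∩ K).Nonempty) :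
      ((⋂ n, H n x) ∩ K).Nonempty := by
    rw [iInter_inter]
    refine IsCompact.nonempty_iInter_of_sequence_nonempty_isCompact_isClosed _ (fun n => ?_) hx
      (((hH 0).isClosed x).inter hK).isCompact fun n => ((hH n).isClosed x).inter hK
    exact inter_subset_inter_left _ (hsub n x)
  have hne (x) : (⋂ n, H n x).Nonempty := by
    simpa using hinter univ isClosed_univ x (by simpa using fun n => (hH n).nonempty x)
  have huniq (x) (z w) (hz : z ∈ ⋂ n, H n x) (hw : w ∈ ⋂ n, H n x) : z = w := by
    rw [mem_iInter] at hz hw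
    have h (n) : f n z = f n w :=
      le_antisymm ((hz (n + 1)).2 w (hw n)) ((hw (n + 1)).2 z (hz n))
    have h' : (fun v => edist z v) = fun v => edist w v :=
      Continuous.ext_on (TopologicalSpace.denseRange_denseSeq Z)
        (continuous_const.edist continuous_id) (continuous_const.edist continuous_id) (by
          rintro _ ⟨n, rfl⟩
          exact h n)
    have := congrFun h' w
    simpa using this
  refine ⟨fun x => (hne x).some, measurable_of_isClosed fun K hK => ?_,
    fun x => mem_iInter.1 (hne x).some_mem 0⟩
  have : (fun x => (hne x).some) ⁻¹' K = ⋂ n, {x | (H n x ∩ K).Nonempty} := by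
    ext x
    simp only [mem_preimage, mem_iInter, mem_ofPred_eq]
    constructor
    · exact fun hx n => ⟨_, mem_iInter.1 (hne x).some_mem n, hx⟩
    · intro hx
      obtain ⟨z, hz, hzK⟩ := hinter K hK x hx
      rwa [huniq x _ z (hne x).some_mem hz]
  rw [this]
  exact MeasurableSet.iInter fun n => (hH n).measurableSet_hit K hK

lemma isClosed_exists_le {X Z : Type*} [TopologicalSpace X] [TopologicalSpace Z] [CompactSpace Z]
    {g : X × Z → ℝ≥0∞} (hg : LowerSemicontinuous g) {K : Set Z} (hK : IsClosed K) (q : ℝ≥0∞) :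
    IsClosed {x | ∃ z ∈ K, g (x, z) ≤ q} := by
  have : {x | ∃ z ∈ K, g (x, z) ≤ q} = Prod.fst '' (g ⁻¹' Iic q ∩ Prod.snd ⁻¹' K) := by
    ext x
    simp [and_comm]
  rw [this]
  exact isClosedMap_fst_of_compactSpace _
    ((hg.isClosed_preimage q).inter (hK.preimage continuous_snd))

/-- Measurable selection of minimisers of a jointly lower semicontinuous function. -/
lemma exists_measurable_argmin {X Z : Type*} [TopologicalSpace X] [MeasurableSpace X]
    [BorelSpace X] [TopologicalSpace Z] [CompactSpace Z] [Nonempty Z]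
    [TopologicalSpace.MetrizableSpace Z] [MeasurableSpace Z] [BorelSpace Z]
    {g : X × Z → ℝ≥0∞} (hg : LowerSemicontinuous g) :
    ∃ s : X → Z, Measurable s ∧ ∀ x z, g (x, s x) ≤ g (x, z) := by
  have h0 : MeasurableMultifunction fun _ : X => (univ : Set Z) :=
    ⟨fun _ => isClosed_univ, fun _ => univ_nonempty, fun K _ => by simp⟩
  obtain ⟨s, hs, hs'⟩ := (h0.argminOn (h := fun x z => g (x, z))
    (fun x => hg.comp (g := fun z => (x, z)) (by fun_prop)) fun K hK q => by
      simpa using (isClosed_exists_le hg hK q).measurableSet).exists_selection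
  exact ⟨s, hs, fun x z => (hs' x).2 z (mem_univ z)⟩

end Selection

section Limit

variable {X Z : Type*} [MeasurableSpace X] [TopologicalSpace Z] [CompactSpace Z]
  [TopologicalSpace.MetrizableSpace Z] [MeasurableSpace Z] [BorelSpace Z]

/-- A decreasing sequence of nonempty midpoint-convex sets of measurable maps into a compact
space with a strictly midpoint-convex function admits an almost everywhere convergent choice. -/
lemma exists_ae_tendsto_of_midpointConvex (μ : Measure X) [IsProbabilityMeasure μ]
    {q : Z → ℝ} (hq : Continuous q) {mid : Z × Z → Z} (hmid : Continuous mid)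
    (hle : ∀ z w, q (mid (z, w)) ≤ (q z + q w) / 2)
    (heq : ∀ z w, q (mid (z, w)) = (q z + q w) / 2 → z = w)
    {K : ℕ → Set (X → Z)} (hK : Antitone K) (hne : ∀ n, (K n).Nonempty)
    (hmeas : ∀ n, ∀ s ∈ K n, Measurable s)
    (hKmid : ∀ n, ∀ s ∈ K n, ∀ s' ∈ K n, (fun x => mid (s x, s' x)) ∈ K n) :
    ∃ (t : ℕ → X → Z) (s : X → Z), (∀ n, t n ∈ K n) ∧ Measurable s ∧
      ∀ᵐ x ∂μ, Tendsto (fun n => t n x) atTop (𝓝 (s x)) := by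
  let := TopologicalSpace.metrizableSpaceMetric Z
  obtain ⟨B, hB⟩ : ∃ B, ∀ z, |q z| ≤ B := by
    obtain ⟨B, hB⟩ := isCompact_univ.exists_bound_of_continuousOn (f := q) hq.continuousOn
    exact ⟨B, fun z => hB z (mem_univ z)⟩
  have hint (s : X → Z) (hs : Measurable s) : Integrable (fun x => q (s x)) μ :=
    Integrable.of_bound (hq.measurable.comp hs).aestronglyMeasurable B (ae_of_all _ fun x => hB _)
  let Q : (X → Z) → ℝ := fun s => ∫ x, q (s x) ∂μ
  have hQ (s : X → Z) : |Q s| ≤ B := by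
    have := norm_integral_le_of_norm_le_const (μ := μ) (f := fun x => q (s x)) (C := B)
      (ae_of_all _ fun x => hB _)
    simpa using this
  let I : ℕ → ℝ := fun n => sInf (Q '' K n)
  have hbdd (n) : BddBelow (Q '' K n) := by
    refine ⟨-B, ?_⟩
    rintro _ ⟨s, -, rfl⟩
    exact (abs_le.1 (hQ s)).1
  have hI (n) (s) (hs : s ∈ K n) : I n ≤ Q s := csInf_le (hbdd n) (mem_image_of_mem Q hs)
  have hImono : Monotone I := fun m n hmn =>
    csInf_le_csInf (hbdd m) ((hne n).image Q) (image_mono (hK hmn))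
  have hIbdd : BddAbove (range I) := by
    refine ⟨B, ?_⟩
    rintro _ ⟨n, rfl⟩
    obtain ⟨s, hs⟩ := hne n
    exact (hI n s hs).trans (abs_le.1 (hQ s)).2
  have hlim : Tendsto I atTop (𝓝 (⨆ n, I n)) := tendsto_atTop_ciSup hImono hIbdd
  have hnear (n : ℕ) : ∃ s ∈ K n, Q s < I n + 1 / (n + 1) := by
    obtain ⟨_, ⟨s, hs, rfl⟩, h⟩ := exists_lt_of_csInf_lt ((hne n).image Q)
      (show sInf (Q '' K n) < I n + 1 / (n + 1) from lt_add_of_pos_right _ (by positivity))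
    exact ⟨s, hs, h⟩
  choose s hsK hsQ using hnear
  have hsm (n) : Measurable (s n) := hmeas n _ (hsK n)
  let D : Z × Z → ℝ := fun p => (q p.1 + q p.2) / 2 - q (mid p)
  have hD : Continuous D := by fun_prop
  have hD0 (p) : 0 ≤ D p := sub_nonneg.2 (hle p.1 p.2)
  let a : ℕ → ℝ := fun n => ((⨆ n, I n) - I n) / 2 + 1 / (n + 1)
  have ha : Tendsto a atTop (𝓝 0) := by
    have h := (((tendsto_const_nhds (x := ⨆ n, I n)).sub hlim).div_const 2).add
      (tendsto_one_div_add_atTop_nhds_zero_nat (𝕜 := ℝ))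
    rwa [sub_self, zero_div, add_zero] at h
  have hDint (n m : ℕ) : Integrable (fun x => D (s n x, s m x)) μ :=
    (((hint _ (hsm n)).add (hint _ (hsm m))).div_const 2).sub
      (hint _ (hmid.measurable.comp ((hsm n).prodMk (hsm m))))
  have hDa (n m : ℕ) (hnm : n ≤ m) : ∫ x, D (s n x, s m x) ∂μ ≤ a n := by
    have h1 : ∫ x, D (s n x, s m x) ∂μ =
        (Q (s n) + Q (s m)) / 2 - Q fun x => mid (s n x, s m x) := by
      simp only [D, Q]
      have e1 : Integrable (fun x => (q (s n x) + q (s m x)) / 2) μ :=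
        ((hint _ (hsm n)).add (hint _ (hsm m))).div_const 2
      have e2 : Integrable (fun x => q (mid (s n x, s m x))) μ :=
        hint _ (hmid.measurable.comp ((hsm n).prodMk (hsm m)))
      rw [integral_sub e1 e2, integral_div, integral_add (hint _ (hsm n)) (hint _ (hsm m))]
    have h2 := hI n _ (hKmid n _ (hsK n) _ (hK hnm (hsK m)))
    have h3 := hsQ n
    have h4 := hsQ m
    have h5 : I m ≤ ⨆ n, I n := le_ciSup hIbdd m
    have h6 : (1 : ℝ) / (m + 1) ≤ 1 / (n + 1) := by gcongr
    rw [h1]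
    simp only [a]
    linarith
  have hδ (k : ℕ) : ∃ δ > 0, ∀ p : Z × Z, (1 / 2 : ℝ) ^ k ≤ dist p.1 p.2 → δ ≤ D p := by
    have hc : IsCompact {p : Z × Z | (1 / 2 : ℝ) ^ k ≤ dist p.1 p.2} :=
      (isClosed_le continuous_const continuous_dist).isCompact
    rcases Set.eq_empty_or_nonempty {p : Z × Z | (1 / 2 : ℝ) ^ k ≤ dist p.1 p.2} with h | h
    · exact ⟨1, one_pos, fun p hp => (notMem_empty p (h ▸ hp)).elim⟩
    · obtain ⟨p, hp, hmin⟩ := hc.exists_isMinOn h hD.continuousOn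
      refine ⟨D p, (hD0 p).lt_of_ne fun h0 => ?_, fun p' hp' => hmin hp'⟩
      have := heq p.1 p.2 (sub_eq_zero.1 h0.symm).symm
      have hp' : (1 / 2 : ℝ) ^ k ≤ dist p.1 p.2 := hp
      rw [this, dist_self] at hp'
      exact absurd hp' (not_le.2 (by positivity))
  choose δ hδ0 hδD using hδ
  obtain ⟨n, hn, hna⟩ : ∃ n : ℕ → ℕ, StrictMono n ∧ ∀ k, a (n k) < δ k * (1 / 2) ^ k := by
    refine extraction_forall_of_eventually
      (P := fun k m => a m < δ k * (1 / 2 : ℝ) ^ k) fun k => ?_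
    exact ha.eventually_lt_const (mul_pos (hδ0 k) (by positivity))
  let A : ℕ → Set X := fun k => {x | (1 / 2 : ℝ) ^ k ≤ dist (s (n k) x) (s (n (k + 1)) x)}
  have hA (k) : μ (A k) ≤ ENNReal.ofReal ((1 / 2) ^ k) := by
    have h1 : A k ⊆ {x | δ k ≤ D (s (n k) x, s (n (k + 1)) x)} := fun x hx => hδD k _ hx
    have h2 := mul_meas_ge_le_integral_of_nonneg (ae_of_all _ fun x => hD0 _)
      (hDint (n k) (n (k + 1))) (δ k)
    have h3 := hDa _ _ (hn (Nat.lt_succ_self k)).le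
    have h4 : μ.real (A k) ≤ (1 / 2) ^ k := by
      have h5 : μ.real (A k) ≤ μ.real {x | δ k ≤ D (s (n k) x, s (n (k + 1)) x)} :=
        measureReal_mono h1
      have := mul_le_mul_of_nonneg_left h5 (hδ0 k).le
      exact le_of_mul_le_mul_left (by linarith [hna k]) (hδ0 k)
    rw [← ofReal_measureReal]
    exact ENNReal.ofReal_le_ofReal h4
  have hBC : ∀ᵐ x ∂μ, ∀ᶠ k in atTop, x ∉ A k := by
    refine ae_eventually_notMem (ne_top_of_le_ne_top ?_ (ENNReal.tsum_le_tsum hA))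
    rw [← ENNReal.ofReal_tsum_of_nonneg (fun k => by positivity) summable_geometric_two]
    exact ENNReal.ofReal_ne_top
  have hconv : ∀ᵐ x ∂μ, ∃ z, Tendsto (fun k => s (n k) x) atTop (𝓝 z) := by
    filter_upwards [hBC] with x hx
    obtain ⟨N, hN⟩ := eventually_atTop.1 hx
    have hc : CauchySeq fun k => s (n (k + N)) x := by
      refine cauchySeq_of_le_geometric (1 / 2) 1 (by norm_num) fun k => ?_
      have h1 : dist (s (n (k + N)) x) (s (n (k + N + 1)) x) < (1 / 2) ^ (k + N) :=
        not_le.1 (hN (k + N) (Nat.le_add_left N k))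
      have h2 : ((1 : ℝ) / 2) ^ (k + N) ≤ (1 / 2) ^ k :=
        pow_le_pow_of_le_one (by norm_num) (by norm_num) (Nat.le_add_right k N)
      rw [one_mul, show k + 1 + N = k + N + 1 by ring]
      exact h1.le.trans h2
    obtain ⟨z, hz⟩ := cauchySeq_tendsto_of_complete hc
    exact ⟨z, (tendsto_add_atTop_iff_nat N).1 hz⟩
  obtain ⟨f, hf, hft⟩ := measurable_limit_of_tendsto_metrizable_ae
    (fun k => (hsm (n k)).aemeasurable) hconv
  exact ⟨fun k => s (n k), f, fun k => hK (hn.le_apply) (hsK (n k)), hf, hft⟩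

end Limit

section Cone

variable {Y : Type*} [MetricSpace Y] [CompactSpace Y] [MeasurableSpace Y] [BorelSpace Y]
  (E : SemiStableCone Y)

lemma sup_mem_carrier {Y : Type*} [TopologicalSpace Y] (E : SemiStableCone Y) {f g : Y → ℝ}
    (hf : f ∈ E.carrier) (hg : g ∈ E.carrier) :
    f ⊔ g ∈ E.carrier := by
  have key (y : Y) : ⨆ h : ({f, g} : Set (Y → ℝ)), h.1 y = (f ⊔ g) y := by
    rw [← sSup_image' (f := fun h : Y → ℝ => h y), image_pair, csSup_pair, Pi.sup_apply]
  obtain ⟨hf1, M, hM⟩ := E.subset_lsc_bdd f hf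
  obtain ⟨hg1, N, hN⟩ := E.subset_lsc_bdd g hg
  have := E.sup_mem {f, g} (by rintro h (rfl | rfl) <;> assumption) ⟨f, mem_insert f _⟩
    (fun y => ((Set.finite_singleton g).insert f |>.image _).bddAbove)
  simp only [key] at this
  refine this ⟨hf1.sup hg1, max M N, fun y => ?_⟩
  exact abs_max_le_max_abs_abs.trans (max_le_max (hM y) (hN y))

lemma exists_monotone_continuous {Y : Type*} [MetricSpace Y] [CompactSpace Y] [Nonempty Y]
    (E : SemiStableCone Y) {φ : Y → ℝ} (hφ : φ ∈ E.carrier) :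
    ∃ g : ℕ → C(Y, ℝ), (∀ n, ⇑(g n) ∈ E.carrier) ∧ (∀ y, Monotone fun n => g n y) ∧
      ∀ y, Tendsto (fun n => g n y) atTop (𝓝 (φ y)) := by
  obtain ⟨S, hSE, hS0, hSc, hSb, hS⟩ := E.sup_continuous φ hφ
  have hlub : IsLUB S φ := by
    rw [isLUB_pi]
    intro y
    rw [hS y, ← sSup_image' (f := fun h : Y → ℝ => h y)]
    exact isLUB_csSup (hS0.image _) (hSb y)
  obtain ⟨S', hS', hc, hlub'⟩ := exists_countable_lowerSemicontinuous_isLUB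
    (fun f hf => (hSc f hf).lowerSemicontinuous) hlub
  have hne : S'.Nonempty := by
    by_contra! h
    subst h
    have := (isLUB_pi.1 hlub' (Classical.arbitrary Y)).2
      (show φ (Classical.arbitrary Y) - 1 ∈ _ by simp)
    linarith
  obtain ⟨u, rfl⟩ := hc.exists_eq_range hne
  have h (n) : partialSups u n ∈ E.carrier ∧ Continuous (partialSups u n) := by
    induction n with
    | zero =>
      rw [partialSups_zero]
      exact ⟨hSE (hS' (mem_range_self 0)), hSc _ (hS' (mem_range_self 0))⟩
    | succ n ih =>
      rw [partialSups_add_one]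
      exact ⟨sup_mem_carrier E ih.1 (hSE (hS' (mem_range_self _))),
        ih.2.sup (hSc _ (hS' (mem_range_self _)))⟩
  have hmono (y : Y) : Monotone fun n => partialSups u n y :=
    fun m n hmn => (partialSups u).monotone hmn y
  refine ⟨fun n => ⟨partialSups u n, (h n).2⟩, fun n => (h n).1, hmono, fun y => ?_⟩
  refine tendsto_atTop_isLUB (hmono y) ?_
  have h1 : IsLUB (range (partialSups u)) φ := by
    rw [IsLUB, upperBounds_range_partialSups]
    exact hlub'
  have := isLUB_pi.1 h1 y
  rwa [← range_comp] at this

lemma integrable_of_mem_carrier {Y : Type*} [TopologicalSpace Y] [MeasurableSpace Y]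
    [BorelSpace Y] (E : SemiStableCone Y) {φ : Y → ℝ} (hφ : φ ∈ E.carrier) (ρ : Measure Y)
    [IsFiniteMeasure ρ] : Integrable φ ρ := by
  obtain ⟨h, M, hM⟩ := E.subset_lsc_bdd φ hφ
  exact Integrable.of_bound h.measurable.aestronglyMeasurable M (ae_of_all _ hM)

lemma tendsto_integral_of_monotone {φ : Y → ℝ} (hφ : φ ∈ E.carrier) {g : ℕ → C(Y, ℝ)}
    (hmono : ∀ y, Monotone fun n => g n y) (hlim : ∀ y, Tendsto (fun n => g n y) atTop (𝓝 (φ y)))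
    (ρ : Measure Y) [IsFiniteMeasure ρ] :
    Tendsto (fun n => ∫ y, g n y ∂ρ) atTop (𝓝 (∫ y, φ y ∂ρ)) :=
  integral_tendsto_of_tendsto_of_monotone (fun n => integrable_continuousMap (g n) ρ)
    (integrable_of_mem_carrier E hφ ρ) (ae_of_all _ hmono) (ae_of_all _ hlim)

lemma eOrder_iff_continuousMap [Nonempty Y] (ρ ρ' : Measure Y) [IsFiniteMeasure ρ]
    [IsFiniteMeasure ρ'] : EOrder E.carrier ρ ρ' ↔
      ∀ f : C(Y, ℝ), ⇑f ∈ E.carrier → ∫ y, f y ∂ρ ≤ ∫ y, f y ∂ρ' := by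
  refine ⟨fun h f hf => h f hf, fun h φ hφ => ?_⟩
  obtain ⟨g, hg, hmono, hlim⟩ := exists_monotone_continuous E hφ
  exact le_of_tendsto_of_tendsto' (tendsto_integral_of_monotone E hφ hmono hlim ρ)
    (tendsto_integral_of_monotone E hφ hmono hlim ρ') fun n => h _ (hg n)

lemma isClosed_eOrder [Nonempty Y] :
    IsClosed {z : ProbabilityMeasure Y × ProbabilityMeasure Y |
      EOrder E.carrier (z.1 : Measure Y) (z.2 : Measure Y)} := by
  simp only [eOrder_iff_continuousMap, ofPred_forall]
  refine isClosed_iInter fun f => isClosed_iInter fun _ => isClosed_le ?_ ?_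
  · exact (ProbabilityMeasure.continuous_integral_continuousMap f).comp continuous_fst
  · exact (ProbabilityMeasure.continuous_integral_continuousMap f).comp continuous_snd

lemma lowerSemicontinuous_integral [Nonempty Y] {φ : Y → ℝ} (hφ : φ ∈ E.carrier) :
    LowerSemicontinuous fun ρ : ProbabilityMeasure Y => ∫ y, φ y ∂(ρ : Measure Y) := by
  intro ρ a ha
  obtain ⟨g, hg, hmono, hlim⟩ := exists_monotone_continuous E hφ
  have hle (n : ℕ) (ρ' : ProbabilityMeasure Y) :
      ∫ y, g n y ∂(ρ' : Measure Y) ≤ ∫ y, φ y ∂(ρ' : Measure Y) :=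
    integral_mono (integrable_continuousMap (g n) _) (integrable_of_mem_carrier E hφ _)
      fun y => (hmono y).ge_of_tendsto (hlim y) n
  obtain ⟨n, hn⟩ := ((tendsto_integral_of_monotone E hφ hmono hlim ρ).eventually_const_lt ha).exists
  filter_upwards [(ProbabilityMeasure.continuous_integral_continuousMap (g n)).continuousAt
    |>.eventually_const_lt hn] with ρ' hρ'
  exact hρ'.trans_le (hle n ρ')

end Cone

section Envelope

variable {Y : Type*} [TopologicalSpace Y] [CompactSpace Y] (E : SemiStableCone Y)

/-- The members of the cone lying below `ψ`. -/
def minorants (ψ : C(Y, ℝ)) : Set (Y → ℝ) := {f | f ∈ E.carrier ∧ f ≤ ψ}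

/-- The largest member of the cone lying below `ψ`. -/
def env (ψ : C(Y, ℝ)) (y : Y) : ℝ := ⨆ f : minorants E ψ, f.1 y

lemma const_mem_minorants (ψ : C(Y, ℝ)) : (fun _ => -‖ψ‖) ∈ minorants E ψ :=
  ⟨E.const_mem _, fun y => (abs_le.1 (ψ.norm_coe_le_norm y)).1⟩

instance (ψ : C(Y, ℝ)) : Nonempty (minorants E ψ) := ⟨⟨_, const_mem_minorants E ψ⟩⟩

lemma bddAbove_minorants {Y : Type*} [TopologicalSpace Y] (E : SemiStableCone Y) (ψ : C(Y, ℝ))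
    (y : Y) : BddAbove (range fun f : minorants E ψ => f.1 y) := by
  refine ⟨ψ y, ?_⟩
  rintro _ ⟨f, rfl⟩
  exact f.2.2 y

lemma env_le (ψ : C(Y, ℝ)) : env E ψ ≤ ψ := fun y => ciSup_le fun f => f.2.2 y

lemma le_env {Y : Type*} [TopologicalSpace Y] (E : SemiStableCone Y) {ψ : C(Y, ℝ)} {φ : Y → ℝ}
    (hφ : φ ∈ E.carrier) (h : φ ≤ ψ) : φ ≤ env E ψ :=
  fun y => le_ciSup (bddAbove_minorants E ψ y) ⟨φ, hφ, h⟩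

lemma env_mem (ψ : C(Y, ℝ)) : env E ψ ∈ E.carrier := by
  refine E.sup_mem (minorants E ψ) (fun f hf => hf.1) ⟨_, const_mem_minorants E ψ⟩ (fun y => ?_)
    ⟨lowerSemicontinuous_ciSup (bddAbove_minorants E ψ)
      fun f => (E.subset_lsc_bdd f.1 f.2.1).1, ‖ψ‖, fun y => abs_le.2 ⟨?_, ?_⟩⟩
  · rw [image_eq_range]
    exact bddAbove_minorants E ψ y
  · exact le_env E (const_mem_minorants E ψ).1 (const_mem_minorants E ψ).2 y
  · exact (env_le E ψ y).trans (abs_le.1 (ψ.norm_coe_le_norm y)).2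

lemma env_smul {c : ℝ} (hc : 0 < c) (ψ : C(Y, ℝ)) (y : Y) : env E (c • ψ) y = c * env E ψ y := by
  apply le_antisymm
  · have h := le_env E (ψ := ψ) (E.smul_mem c⁻¹ (inv_nonneg.2 hc.le) _ (env_mem E (c • ψ)))
      (fun z => by
        have := env_le E (c • ψ) z
        rw [ContinuousMap.smul_apply, smul_eq_mul] at this
        rwa [inv_mul_le_iff₀ hc]) y
    rwa [inv_mul_le_iff₀ hc] at h
  · refine le_env E (ψ := c • ψ) (E.smul_mem c hc.le _ (env_mem E ψ)) (fun z => ?_) y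
    exact mul_le_mul_of_nonneg_left (env_le E ψ z) hc.le

lemma env_add_le (ψ ψ' : C(Y, ℝ)) (y : Y) : env E ψ y + env E ψ' y ≤ env E (ψ + ψ') y :=
  le_env E (E.add_mem _ (env_mem E ψ) _ (env_mem E ψ'))
    (fun z => add_le_add (env_le E ψ z) (env_le E ψ' z)) y

end Envelope

lemma exists_linear_le_sublinear {V : Type*} [AddCommGroup V] [Module ℝ V] (N : V → ℝ)
    (N_hom : ∀ c : ℝ, 0 < c → ∀ x, N (c • x) = c * N x) (N_add : ∀ x y, N (x + y) ≤ N x + N y)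
    (x : V) : ∃ L : V →ₗ[ℝ] ℝ, L x = N x ∧ ∀ v, L v ≤ N v := by
  have N_0 : N 0 = 0 := by
    have := N_hom 2 two_pos 0
    rw [smul_zero] at this
    linarith
  have H (c : ℝ) (hc : c • x = 0) : RingHom.id ℝ c • N x = 0 := by
    rcases smul_eq_zero.1 hc with rfl | rfl
    · simp
    · simp [N_0]
  obtain ⟨L, hL, hLN⟩ := exists_extension_of_le_sublinear
    (LinearPMap.mkSpanSingleton' x (N x) H) N N_hom N_add (by
      rintro ⟨v, hv⟩
      obtain ⟨c, rfl⟩ := Submodule.mem_span_singleton.1 hv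
      rw [LinearPMap.mkSpanSingleton'_apply, RingHom.id_apply, smul_eq_mul]
      rcases lt_trichotomy c 0 with hc | rfl | hc
      · have h1 := N_add (c • x) ((-c) • x)
        rw [← add_smul, add_neg_cancel, zero_smul, N_0, N_hom (-c) (neg_pos.2 hc)] at h1
        simp only
        linarith
      · simp [N_0]
      · exact (N_hom c hc x).ge)
  refine ⟨L, ?_, hLN⟩
  rw [hL ⟨x, Submodule.mem_span_singleton_self x⟩]
  exact LinearPMap.mkSpanSingleton'_apply_self _ _ _ _

section Riesz

variable {Y : Type*} [MetricSpace Y] [CompactSpace Y] [MeasurableSpace Y] [BorelSpace Y]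

lemma exists_measure_of_positive (L : C(Y, ℝ) →ₗ[ℝ] ℝ) (hpos : ∀ f : C(Y, ℝ), 0 ≤ f → 0 ≤ L f)
    (hone : L 1 = 1) :
    ∃ ρ : Measure Y, IsProbabilityMeasure ρ ∧ ∀ f : C(Y, ℝ), ∫ y, f y ∂ρ = L f := by
  let toC : C(Y, ℝ) → CompactlySupportedContinuousMap Y ℝ := fun f =>
    { toFun := f
      hasCompactSupport' := HasCompactSupport.of_compactSpace _ }
  let Λ : CompactlySupportedContinuousMap Y ℝ →ₚ[ℝ] ℝ :=
    { toFun := fun g => L g.toContinuousMap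
      map_add' := fun g g' => L.map_add g.toContinuousMap g'.toContinuousMap
      map_smul' := fun c g => L.map_smul c g.toContinuousMap
      monotone' := fun g g' h => by
        have h0 : 0 ≤ g'.toContinuousMap - g.toContinuousMap := fun y => sub_nonneg.2 (h y)
        have := hpos _ h0
        rw [map_sub] at this
        exact sub_nonneg.1 this }
  have hint (f : C(Y, ℝ)) : ∫ y, f y ∂(RealRMK.rieszMeasure Λ) = L f :=
    RealRMK.integral_rieszMeasure Λ (toC f)
  have hle : RealRMK.rieszMeasure Λ univ ≤ ENNReal.ofReal (Λ (toC 1)) :=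
    RealRMK.rieszMeasure_le_of_eq_one Λ (fun x => zero_le_one) isCompact_univ fun x _ => rfl
  have : IsFiniteMeasure (RealRMK.rieszMeasure Λ) := ⟨hle.trans_lt ENNReal.ofReal_lt_top⟩
  refine ⟨RealRMK.rieszMeasure Λ, ?_, hint⟩
  have h1 := hint 1
  rw [hone] at h1
  simp only [ContinuousMap.one_apply, integral_const, smul_eq_mul, mul_one] at h1
  exact ⟨by rwa [measureReal_def, ENNReal.toReal_eq_one_iff] at h1⟩

/-- Every probability measure is dominated, in the order of the cone, by one whose integral of `ψ`
is at most the original integral of the envelope of `ψ`. -/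
lemma exists_eOrder_integral_le_env [Nonempty Y] (E : SemiStableCone Y) (ψ : C(Y, ℝ))
    (ξ : Measure Y) [IsProbabilityMeasure ξ] :
    ∃ ρ : Measure Y, IsProbabilityMeasure ρ ∧ EOrder E.carrier ξ ρ ∧
      ∫ y, ψ y ∂ρ ≤ ∫ y, env E ψ y ∂ξ := by
  have hi (f : C(Y, ℝ)) : Integrable (env E f) ξ := integrable_of_mem_carrier E (env_mem E f) ξ
  obtain ⟨L, hL, hLN⟩ := exists_linear_le_sublinear (fun f : C(Y, ℝ) => -∫ y, env E (-f) y ∂ξ)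
    (fun c hc f => by
      simp only [← smul_neg, env_smul E hc]
      rw [integral_const_mul, mul_neg])
    (fun f g => by
      rw [← neg_add, neg_le_neg_iff, ← integral_add (hi _) (hi _), neg_add]
      exact integral_mono ((hi _).add (hi _)) (hi _) (env_add_le E (-f) (-g)))
    (-ψ)
  have hLE (f : C(Y, ℝ)) (φ : Y → ℝ) (hφ : φ ∈ E.carrier) (hle : φ ≤ f) : ∫ y, φ y ∂ξ ≤ L f := by
    have h1 := hLN (-f)
    rw [map_neg, neg_neg, neg_le_neg_iff] at h1
    exact (integral_mono (integrable_of_mem_carrier E hφ ξ) (hi f) (le_env E hφ hle)).trans h1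
  obtain ⟨ρ, hρ, hρL⟩ := exists_measure_of_positive L (fun f hf => by
      simpa using hLE f _ (E.const_mem 0) hf) (by
      apply le_antisymm
      · have := hLE (-1) _ (E.const_mem (-1)) fun y => le_rfl
        rw [map_neg] at this
        simp at this
        linarith
      · simpa using hLE 1 _ (E.const_mem 1) fun y => le_rfl)
  refine ⟨ρ, hρ, (eOrder_iff_continuousMap E ξ ρ).2 fun f hf => ?_, ?_⟩
  · rw [hρL]
    exact hLE f f hf le_rfl
  · rw [map_neg, neg_neg] at hL
    rw [hρL]
    linarith

end Riesz

/-- A convex set of pairs (cost, linear functional) which satisfies a weak duality bound against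
every test vector contains a pair that nearly realises any finite number of constraints. -/
lemma exists_mem_approx_of_forall_exists_le {V : Type*} [AddCommGroup V] [Module ℝ V]
    {K : Set (ℝ × (V →ₗ[ℝ] ℝ))} (hK : Convex ℝ K) (h0 : ∀ p ∈ K, 0 ≤ p.1) {S : ℝ}
    (ν : V →ₗ[ℝ] ℝ) (H : ∀ v, ∃ p ∈ K, p.1 + p.2 v ≤ S + ν v) {n : ℕ} (f : Fin n → V) {δ : ℝ}
    (hδ : 0 < δ) : ∃ p ∈ K, p.1 ≤ S + δ ∧ ∀ i, |p.2 (f i) - ν (f i)| ≤ δ := by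
  by_contra! hcon
  let T : ℝ × (V →ₗ[ℝ] ℝ) →ₗ[ℝ] ℝ × (Fin n → ℝ) :=
    { toFun := fun p => (p.1, fun i => p.2 (f i))
      map_add' := fun p p' => rfl
      map_smul' := fun c p => rfl }
  let c : Fin n → ℝ := fun i => ν (f i)
  have hdisj : Disjoint (Iio (S + δ) ×ˢ Metric.ball c δ) (T '' K) := by
    rw [Set.disjoint_left]
    rintro _ ⟨h1, h2⟩ ⟨p, hp, rfl⟩
    obtain ⟨i, hi⟩ := hcon p hp (le_of_lt h1)
    have h3 := (dist_pi_lt_iff hδ).1 (Metric.mem_ball.1 h2) i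
    exact hi.not_gt h3
  obtain ⟨φ, u, hU, hV⟩ := geometric_hahn_banach_open ((convex_Iio _).prod (convex_ball c δ))
    (isOpen_Iio.prod Metric.isOpen_ball) (hK.linear_image T) hdisj
  set a : ℝ := φ (1, 0) with ha
  let b : Fin n → ℝ := fun i => φ (0, Pi.single i 1)
  have hφ (r : ℝ) (x : Fin n → ℝ) : φ (r, x) = a * r + ∑ i, x i * b i := by
    have h1 : (r, x) = r • ((1 : ℝ), (0 : Fin n → ℝ)) +
        ∑ i, x i • ((0 : ℝ), (Pi.single i 1 : Fin n → ℝ)) := by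
      ext j
      · simp [Prod.fst_sum]
      · simp [Prod.snd_sum, Finset.sum_apply, Pi.single_apply]
    rw [h1, map_add, map_sum, map_smul, smul_eq_mul, mul_comm]
    simp only [map_smul, smul_eq_mul, b, ha]
  let w : V := ∑ i, b i • f i
  have hw (L : V →ₗ[ℝ] ℝ) : L w = ∑ i, L (f i) * b i := by
    simp [w, mul_comm]
  have hK' (p) (hp : p ∈ K) : u ≤ a * p.1 + p.2 w := by
    have := hV _ (mem_image_of_mem T hp)
    rwa [show T p = (p.1, fun i => p.2 (f i)) from rfl, hφ, ← hw] at this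
  have hU' (r : ℝ) (hr : r < S + δ) : a * r + ν w < u := by
    have := hU (r, c) ⟨hr, Metric.mem_ball_self hδ⟩
    rwa [hφ, ← hw] at this
  have ha0 : 0 ≤ a := by
    by_contra! hneg
    have h1 := hU' (min S ((u - ν w) / a)) ((min_le_left _ _).trans_lt (by linarith))
    have h2 : a * ((u - ν w) / a) ≤ a * min S ((u - ν w) / a) :=
      mul_le_mul_of_nonpos_left (min_le_right _ _) hneg.le
    rw [mul_div_cancel₀ _ hneg.ne] at h2
    linarith
  rcases ha0.eq_or_lt with h | hpos
  · rw [← h] at hK' hU'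
    have h1 := hU' S (by linarith)
    have hgap : 0 < u - ν w := by linarith
    obtain ⟨N, hN⟩ := exists_nat_gt (S / (u - ν w))
    obtain ⟨p, hp, hle⟩ := H ((N : ℝ) • w)
    have h2 := hK' p hp
    have h3 := h0 p hp
    rw [map_smul, map_smul, smul_eq_mul, smul_eq_mul] at hle
    rw [div_lt_iff₀ hgap] at hN
    have h4 : (N : ℝ) * (u - ν w) ≤ N * (p.2 w - ν w) := by
      gcongr
      linarith
    linarith
  · obtain ⟨p, hp, hle⟩ := H (a⁻¹ • w)
    have h2 := hK' p hp
    have h1 := hU' S (by linarith)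
    rw [map_smul, map_smul, smul_eq_mul, smul_eq_mul] at hle
    have h3 := mul_le_mul_of_nonneg_left hle hpos.le
    rw [mul_add, mul_add, mul_inv_cancel_left₀ hpos.ne', mul_inv_cancel_left₀ hpos.ne'] at h3
    linarith

section Existence

variable {Y : Type*} [MetricSpace Y] [CompactSpace Y] [MeasurableSpace Y] [BorelSpace Y]

/-- Componentwise convex combination of pairs of probability measures. -/
def mixPair (t : ℝ≥0∞) (ht : t ≤ 1) (z w : ProbabilityMeasure Y × ProbabilityMeasure Y) :
    ProbabilityMeasure Y × ProbabilityMeasure Y :=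
  (mix t ht z.1 w.1, mix t ht z.2 w.2)

lemma continuous_mixPair {t : ℝ≥0∞} (ht : t ≤ 1) :
    Continuous fun q : (ProbabilityMeasure Y × ProbabilityMeasure Y) ×
      (ProbabilityMeasure Y × ProbabilityMeasure Y) => mixPair t ht q.1 q.2 := by
  have h := continuous_mix (Y := Y) ht
  exact (h.comp (by fun_prop : Continuous fun q : (ProbabilityMeasure Y × ProbabilityMeasure Y) ×
      (ProbabilityMeasure Y × ProbabilityMeasure Y) => (q.1.1, q.2.1))).prodMk
    (h.comp (by fun_prop : Continuous fun q : (ProbabilityMeasure Y × ProbabilityMeasure Y) ×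
      (ProbabilityMeasure Y × ProbabilityMeasure Y) => (q.1.2, q.2.2)))

/-- Integration of continuous functions as a linear functional. -/
def integralLin (ρ : ProbabilityMeasure Y) : C(Y, ℝ) →ₗ[ℝ] ℝ where
  toFun f := ∫ y, f y ∂(ρ : Measure Y)
  map_add' f g := integral_add (integrable_continuousMap f _) (integrable_continuousMap g _)
  map_smul' c f := integral_const_mul c f

lemma continuous_integralLin (f : C(Y, ℝ)) :
    Continuous fun ρ : ProbabilityMeasure Y => integralLin ρ f :=
  ProbabilityMeasure.continuous_integral_continuousMap f

lemma abs_integralLin_le (f : C(Y, ℝ)) (ρ : ProbabilityMeasure Y) : |integralLin ρ f| ≤ ‖f‖ :=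
  abs_integral_continuousMap_le f _

lemma integralLin_mix {t : ℝ≥0∞} (ht : t ≤ 1) (ρ ρ' : ProbabilityMeasure Y) (f : C(Y, ℝ)) :
    integralLin (mix t ht ρ ρ') f =
      t.toReal * integralLin ρ f + (1 - t.toReal) * integralLin ρ' f :=
  integral_mix ht ρ ρ' (integrable_continuousMap _ _) (integrable_continuousMap _ _)

lemma integralLin_const (ρ : ProbabilityMeasure Y) (c : ℝ) :
    integralLin ρ (ContinuousMap.const Y c) = c := by
  simp [integralLin]

variable {X : Type*} [MeasurableSpace X]

lemma integrable_integralLin {κ : X → ProbabilityMeasure Y} (hκ : Measurable κ) (μ : Measure X)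
    [IsFiniteMeasure μ] (f : C(Y, ℝ)) : Integrable (fun x => integralLin (κ x) f) μ :=
  Integrable.of_bound ((continuous_integralLin f).measurable.comp hκ).aestronglyMeasurable ‖f‖
    (ae_of_all _ fun _ => abs_integralLin_le f _)

/-- The averaged linear functional of a measurable family of probability measures. -/
def averageLin (μ : Measure X) [IsFiniteMeasure μ] (κ : X → ProbabilityMeasure Y)
    (hκ : Measurable κ) : C(Y, ℝ) →ₗ[ℝ] ℝ where
  toFun f := ∫ x, integralLin (κ x) f ∂μ
  map_add' f g := by
    simp only [map_add]
    exact integral_add (integrable_integralLin hκ μ f) (integrable_integralLin hκ μ g)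
  map_smul' c f := by
    simp only [map_smul, smul_eq_mul]
    exact integral_const_mul c _

lemma averageLin_mix (μ : Measure X) [IsFiniteMeasure μ] {κ κ' : X → ProbabilityMeasure Y}
    (hκ : Measurable κ) (hκ' : Measurable κ') {t : ℝ≥0∞} (ht : t ≤ 1)
    (hm : Measurable fun x => mix t ht (κ x) (κ' x)) (f : C(Y, ℝ)) :
    averageLin μ (fun x => mix t ht (κ x) (κ' x)) hm f =
      t.toReal * averageLin μ κ hκ f + (1 - t.toReal) * averageLin μ κ' hκ' f := by
  change ∫ x, integralLin (mix t ht (κ x) (κ' x)) f ∂μ = _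
  simp only [integralLin_mix]
  rw [integral_add ((integrable_integralLin hκ μ f).const_mul _)
    ((integrable_integralLin hκ' μ f).const_mul _), integral_const_mul, integral_const_mul]
  rfl

variable [TopologicalSpace X] [BorelSpace X]
  {g : X × (ProbabilityMeasure Y × ProbabilityMeasure Y) → ℝ≥0∞}

lemma measurable_comp_graph (hg : LowerSemicontinuous g)
    {s : X → ProbabilityMeasure Y × ProbabilityMeasure Y} (hs : Measurable s) :
    Measurable fun x => g (x, s x) :=
  hg.measurable.comp (measurable_id.prodMk hs)

/-- Convexity of a cost in its second argument. -/
def ConvexCost (g : X × (ProbabilityMeasure Y × ProbabilityMeasure Y) → ℝ≥0∞) : Prop :=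
  ∀ t : ℝ≥0∞, ∀ ht : t ≤ 1, ∀ x z w,
    g (x, mixPair t ht z w) ≤ t * g (x, z) + (1 - t) * g (x, w)

lemma lintegral_mixPair_le (hg : LowerSemicontinuous g) (hconv : ConvexCost g) (μ : Measure X)
    {s s' : X → ProbabilityMeasure Y × ProbabilityMeasure Y} (hs : Measurable s)
    (hs' : Measurable s') {t : ℝ≥0∞} (ht : t ≤ 1) :
    ∫⁻ x, g (x, mixPair t ht (s x) (s' x)) ∂μ ≤
      t * ∫⁻ x, g (x, s x) ∂μ + (1 - t) * ∫⁻ x, g (x, s' x) ∂μ := by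
  rw [← lintegral_const_mul _ (measurable_comp_graph hg hs),
    ← lintegral_const_mul _ (measurable_comp_graph hg hs'),
    ← lintegral_add_left ((measurable_comp_graph hg hs).const_mul _)]
  exact lintegral_mono fun x => hconv t ht x _ _

/-- The pairs of a bound on the cost and an averaged functional realised by measurable maps. -/
def realisable (g : X × (ProbabilityMeasure Y × ProbabilityMeasure Y) → ℝ≥0∞) (μ : Measure X)
    [IsFiniteMeasure μ] : Set (ℝ × (C(Y, ℝ) →ₗ[ℝ] ℝ)) :=
  {p | ∃ s : X → ProbabilityMeasure Y × ProbabilityMeasure Y, ∃ hs : Measurable s,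
    0 ≤ p.1 ∧ ∫⁻ x, g (x, s x) ∂μ ≤ ENNReal.ofReal p.1 ∧
    p.2 = averageLin μ (fun x => (s x).2) hs.snd}

lemma convex_realisable (hg : LowerSemicontinuous g) (hconv : ConvexCost g) (μ : Measure X)
    [IsFiniteMeasure μ] : Convex ℝ (realisable g μ) := by
  rintro ⟨r, L⟩ ⟨s, hs, h0, hle, rfl⟩ ⟨r', L'⟩ ⟨s', hs', h0', hle', rfl⟩ a b ha hb hab
  have ht : ENNReal.ofReal a ≤ 1 := ENNReal.ofReal_le_one.2 (by linarith)
  have hb' : 1 - ENNReal.ofReal a = ENNReal.ofReal b := by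
    rw [← ENNReal.ofReal_one, ← ENNReal.ofReal_sub _ ha]
    congr 1
    linarith
  have hm : Measurable fun x => mixPair (ENNReal.ofReal a) ht (s x) (s' x) :=
    (continuous_mixPair ht).measurable.comp (hs.prodMk hs')
  refine ⟨_, hm, ?_, ?_, ?_⟩
  · change 0 ≤ a * r + b * r'
    simp only at h0 h0'
    positivity
  · refine (lintegral_mixPair_le hg hconv μ hs hs' ht).trans ?_
    change _ ≤ ENNReal.ofReal (a * r + b * r')
    simp only at h0 h0'
    rw [ENNReal.ofReal_add (by positivity) (by positivity), ENNReal.ofReal_mul ha,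
      ENNReal.ofReal_mul hb, hb']
    gcongr
  · ext f
    refine Eq.trans ?_ (averageLin_mix μ hs.snd hs'.snd ht hm.snd f).symm
    rw [ENNReal.toReal_ofReal ha, show 1 - a = b by linarith]
    rfl

lemma exists_realisable_le (hg : LowerSemicontinuous g) (μ : Measure X) [IsProbabilityMeasure μ]
    (ν : ProbabilityMeasure Y) {S : ℝ} (hS : 0 ≤ S)
    (H : ∀ ψ : C(Y, ℝ), 0 ≤ ψ → ∫⁻ x, ⨅ z : ProbabilityMeasure Y × ProbabilityMeasure Y,
      (g (x, z) + ENNReal.ofReal (integralLin z.2 ψ)) ∂μ ≤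
        ENNReal.ofReal S + ENNReal.ofReal (integralLin ν ψ)) (v : C(Y, ℝ)) :
    ∃ p ∈ realisable g μ, p.1 + p.2 v ≤ S + integralLin ν v := by
  let ψ : C(Y, ℝ) := v + ContinuousMap.const Y ‖v‖
  have hψ : 0 ≤ ψ := fun y => by
    have := (abs_le.1 (v.norm_coe_le_norm y)).1
    change 0 ≤ v y + ‖v‖
    linarith
  have hpos (ρ : ProbabilityMeasure Y) : 0 ≤ integralLin ρ ψ := integral_nonneg hψ
  have hsplit (ρ : ProbabilityMeasure Y) : integralLin ρ ψ = integralLin ρ v + ‖v‖ := by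
    rw [map_add, integralLin_const]
  have hg' : LowerSemicontinuous fun q : X × (ProbabilityMeasure Y × ProbabilityMeasure Y) =>
      g q + ENNReal.ofReal (integralLin q.2.2 ψ) := by
    refine hg.add (Continuous.lowerSemicontinuous ?_)
    exact ENNReal.continuous_ofReal.comp ((continuous_integralLin ψ).comp (by fun_prop))
  have : Nonempty (ProbabilityMeasure Y) := ⟨ν⟩
  obtain ⟨s, hs, hmin⟩ := exists_measurable_argmin hg'
  have h1 : ∫⁻ x, (g (x, s x) + ENNReal.ofReal (integralLin (s x).2 ψ)) ∂μ ≤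
      ENNReal.ofReal S + ENNReal.ofReal (integralLin ν ψ) :=
    (lintegral_mono fun x => le_iInf fun z => hmin x z).trans (H ψ hψ)
  rw [lintegral_add_left (measurable_comp_graph hg hs),
    ← ofReal_integral_eq_lintegral_ofReal (integrable_integralLin hs.snd μ ψ)
      (ae_of_all _ fun x => hpos _), ← ENNReal.ofReal_add hS (hpos ν)] at h1
  have hfin : ∫⁻ x, g (x, s x) ∂μ ≠ ∞ :=
    ne_top_of_le_ne_top ENNReal.ofReal_ne_top (le_self_add.trans h1)
  refine ⟨((∫⁻ x, g (x, s x) ∂μ).toReal, averageLin μ (fun x => (s x).2) hs.snd),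
    ⟨s, hs, ENNReal.toReal_nonneg, (ENNReal.ofReal_toReal hfin).ge, rfl⟩, ?_⟩
  have h2 : 0 ≤ ∫ x, integralLin (s x).2 ψ ∂μ := integral_nonneg fun x => hpos _
  rw [← ENNReal.ofReal_toReal hfin, ← ENNReal.ofReal_add ENNReal.toReal_nonneg h2,
    ENNReal.ofReal_le_ofReal_iff (add_nonneg hS (hpos ν))] at h1
  simp only [hsplit] at h1
  rw [integral_add (integrable_integralLin hs.snd μ v) (integrable_const _)] at h1
  simp only [integral_const, probReal_univ, one_smul] at h1
  change _ + ∫ x, integralLin (s x).2 v ∂μ ≤ _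
  simp only
  linarith

lemma exists_minimising_map (hg : LowerSemicontinuous g) (hconv : ConvexCost g) (μ : Measure X)
    [IsProbabilityMeasure μ] (ν : ProbabilityMeasure Y) {S : ℝ} (hS : 0 ≤ S)
    (H : ∀ ψ : C(Y, ℝ), 0 ≤ ψ → ∫⁻ x, ⨅ z : ProbabilityMeasure Y × ProbabilityMeasure Y,
      (g (x, z) + ENNReal.ofReal (integralLin z.2 ψ)) ∂μ ≤
        ENNReal.ofReal S + ENNReal.ofReal (integralLin ν ψ)) :
    ∃ s : X → ProbabilityMeasure Y × ProbabilityMeasure Y, Measurable s ∧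
      ∫⁻ x, g (x, s x) ∂μ ≤ ENNReal.ofReal S ∧
      ∀ j, ∫ x, moments (s x).2 j ∂μ = moments ν j := by
  have hhalf : (2⁻¹ : ℝ≥0∞) ≤ 1 := ENNReal.inv_le_one.2 one_le_two
  let K : ℕ → Set (X → ProbabilityMeasure Y × ProbabilityMeasure Y) := fun n =>
    {s | Measurable s ∧ ∫⁻ x, g (x, s x) ∂μ ≤ ENNReal.ofReal (S + 1 / (n + 1)) ∧
      ∀ j < n, |∫ x, moments (s x).2 j ∂μ - moments ν j| ≤ 1 / (n + 1)}
  have hK : Antitone K := by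
    rintro m n hmn s ⟨hs, h1, h2⟩
    have h3 : (1 : ℝ) / (n + 1) ≤ 1 / (m + 1) := by gcongr
    refine ⟨hs, h1.trans (ENNReal.ofReal_le_ofReal (by linarith)), fun j hj => ?_⟩
    exact (h2 j (hj.trans_le hmn)).trans h3
  have hne (n) : (K n).Nonempty := by
    obtain ⟨p, ⟨s, hs, h0, hle, hp⟩, h1, h2⟩ := exists_mem_approx_of_forall_exists_le
      (convex_realisable hg hconv μ) (fun p ⟨_, _, h, _⟩ => h) (integralLin ν)
      (exists_realisable_le hg μ ν hS H)
      (fun i : Fin n => TopologicalSpace.denseSeq C(Y, ℝ) i) (δ := 1 / ((n : ℝ) + 1))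
      (by positivity)
    refine ⟨s, hs, hle.trans (ENNReal.ofReal_le_ofReal h1), fun j hj => ?_⟩
    have := h2 ⟨j, hj⟩
    rwa [hp] at this
  have hmid (n) : ∀ s ∈ K n, ∀ s' ∈ K n, (fun x => mixPair 2⁻¹ hhalf (s x) (s' x)) ∈ K n := by
    rintro s ⟨hs, h1, h2⟩ s' ⟨hs', h1', h2'⟩
    have hm : Measurable fun x => mixPair 2⁻¹ hhalf (s x) (s' x) :=
      (continuous_mixPair hhalf).measurable.comp (hs.prodMk hs')
    refine ⟨hm, ?_, fun j hj => ?_⟩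
    · refine (lintegral_mixPair_le hg hconv μ hs hs' hhalf).trans ?_
      calc _ ≤ 2⁻¹ * ENNReal.ofReal (S + 1 / (n + 1)) +
            (1 - 2⁻¹) * ENNReal.ofReal (S + 1 / (n + 1)) := by gcongr
        _ = _ := by rw [← add_mul, add_tsub_cancel_of_le hhalf, one_mul]
    · have h3 := averageLin_mix μ hs.snd hs'.snd hhalf hm.snd
        (TopologicalSpace.denseSeq C(Y, ℝ) j)
      rw [ENNReal.toReal_inv, ENNReal.toReal_ofNat] at h3
      change ∫ x, moments (mixPair 2⁻¹ hhalf (s x) (s' x)).2 j ∂μ =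
        2⁻¹ * ∫ x, moments (s x).2 j ∂μ + (1 - 2⁻¹) * ∫ x, moments (s' x).2 j ∂μ at h3
      rw [h3]
      have h4 := abs_le.1 (h2 j hj)
      have h5 := abs_le.1 (h2' j hj)
      exact abs_le.2 ⟨by linarith, by linarith⟩
  obtain ⟨q, hq, hqconv⟩ := exists_strictlyConvex Y
  obtain ⟨t, s, htK, hs, hlim⟩ := exists_ae_tendsto_of_midpointConvex μ
    (q := fun z : ProbabilityMeasure Y × ProbabilityMeasure Y => q z.1 + q z.2) (by fun_prop)
    (mid := fun p => mixPair 2⁻¹ hhalf p.1 p.2) (continuous_mixPair hhalf)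
    (fun z w => by
      have h1 := (hqconv _ hhalf rfl z.1 w.1).1
      have h2 := (hqconv _ hhalf rfl z.2 w.2).1
      simp only [mixPair]
      linarith)
    (fun z w h => by
      have h1 := hqconv _ hhalf rfl z.1 w.1
      have h2 := hqconv _ hhalf rfl z.2 w.2
      simp only [mixPair] at h
      exact Prod.ext (h1.2 (by linarith [h1.1, h2.1])) (h2.2 (by linarith [h1.1, h2.1])))
    hK hne (fun n s hs => hs.1) hmid
  refine ⟨s, hs, ?_, fun j => ?_⟩
  · have h1 : ∀ᵐ x ∂μ, g (x, s x) ≤ liminf (fun n => g (x, t n x)) atTop := by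
      filter_upwards [hlim] with x hx
      refine le_of_forall_lt_imp_le_of_dense fun a ha => ?_
      refine le_liminf_of_le (by isBoundedDefault) ?_
      filter_upwards [(tendsto_const_nhds.prodMk_nhds hx).eventually (hg (x, s x) a ha)] with n hn
      exact hn.le
    have h2 : Tendsto (fun n : ℕ => ENNReal.ofReal (S + 1 / (n + 1))) atTop
        (𝓝 (ENNReal.ofReal S)) := by
      have := tendsto_one_div_add_atTop_nhds_zero_nat.const_add S
      rw [add_zero] at this
      exact ENNReal.tendsto_ofReal this
    calc ∫⁻ x, g (x, s x) ∂μ ≤ ∫⁻ x, liminf (fun n => g (x, t n x)) atTop ∂μ :=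
          lintegral_mono_ae h1
      _ ≤ liminf (fun n => ∫⁻ x, g (x, t n x) ∂μ) atTop :=
          lintegral_liminf_le fun n => measurable_comp_graph hg (htK n).1
      _ ≤ liminf (fun n : ℕ => ENNReal.ofReal (S + 1 / (n + 1))) atTop :=
          liminf_le_liminf (Eventually.of_forall fun n => (htK n).2.1)
      _ = ENNReal.ofReal S := h2.liminf_eq
  · have hc : Continuous fun ρ : ProbabilityMeasure Y => moments ρ j :=
      (continuous_apply j).comp continuous_moments
    have h1 : Tendsto (fun n => ∫ x, moments (t n x).2 j ∂μ) atTop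
        (𝓝 (∫ x, moments (s x).2 j ∂μ)) := by
      refine tendsto_integral_of_dominated_convergence
        (fun _ => ‖TopologicalSpace.denseSeq C(Y, ℝ) j‖)
        (fun n => (hc.measurable.comp (htK n).1.snd).aestronglyMeasurable) (integrable_const _)
        (fun n => ae_of_all _ fun x => abs_integral_continuousMap_le _ _) ?_
      filter_upwards [hlim] with x hx
      exact ((hc.comp continuous_snd).tendsto (s x)).comp hx
    refine tendsto_nhds_unique h1 (tendsto_iff_dist_tendsto_zero.2 ?_)
    refine squeeze_zero' (Eventually.of_forall fun n => dist_nonneg) ?_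
      (tendsto_one_div_add_atTop_nhds_zero_nat (𝕜 := ℝ))
    filter_upwards [eventually_gt_atTop j] with n hn
    exact (htK n).2.2 j hn

end Existence

section Extended

lemma coe_ofReal_add_sub {r M : ℝ} (h : 0 ≤ r + M) (c : ℝ≥0∞) :
    ((ENNReal.ofReal (r + M) + c : ℝ≥0∞) : EReal) - (M : EReal) = (r : EReal) + (c : EReal) := by
  rw [EReal.coe_ennreal_add, EReal.coe_ennreal_ofReal, max_eq_left h]
  induction c with
  | top => rfl
  | coe c =>
    change ((r + M + (c : ℝ) - M : ℝ) : EReal) = ((r + (c : ℝ) : ℝ) : EReal)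
    congr 1
    ring

lemma erealToENN_coe (a : ℝ≥0∞) : erealToENN (a : EReal) = a := by
  induction a with
  | top => simp [erealToENN]
  | coe c => simp [erealToENN]

lemma erealToENN_of_nonpos {a : EReal} (ha : a ≤ 0) : erealToENN a = 0 := by
  rw [erealToENN, if_neg (ha.trans_lt EReal.zero_lt_top).ne, ENNReal.ofReal_eq_zero]
  exact EReal.toReal_nonpos ha

lemma erealToENN_coe_sub (a : ℝ≥0∞) {M : ℝ} (hM : 0 ≤ M) :
    erealToENN ((a : EReal) - (M : EReal)) = a - ENNReal.ofReal M := by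
  induction a with
  | top => simp [erealToENN]
  | coe c =>
    change erealToENN (((c : ℝ) - M : ℝ) : EReal) = _
    rw [erealToENN, if_neg (EReal.coe_ne_top _), EReal.toReal_coe, ENNReal.ofReal_sub _ hM,
      ENNReal.ofReal_coe_nnreal]

lemma erealToENN_neg_coe_sub (a : ℝ≥0∞) (M : ℝ) :
    erealToENN (-((a : EReal) - (M : EReal))) = ENNReal.ofReal M - a := by
  induction a with
  | top => simp [erealToENN]
  | coe c =>
    change erealToENN ((-((c : ℝ) - M) : ℝ) : EReal) = _
    rw [erealToENN, if_neg (EReal.coe_ne_top _), EReal.toReal_coe, neg_sub,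
      ENNReal.ofReal_sub M (NNReal.coe_nonneg c), ENNReal.ofReal_coe_nnreal]

lemma eInt_coe_sub {X : Type*} [MeasurableSpace X] (μ : Measure X) [IsProbabilityMeasure μ]
    {m : X → ℝ≥0∞} (hm : Measurable m) {M : ℝ} (hM : 0 ≤ M) :
    eInt μ (fun x => (m x : EReal) - (M : EReal)) = ((∫⁻ x, m x ∂μ : ℝ≥0∞) : EReal) - M := by
  have h1 : ∫⁻ x, (m x - ENNReal.ofReal M) ∂μ + ENNReal.ofReal M =
      ∫⁻ x, m x ∂μ + ∫⁻ x, (ENNReal.ofReal M - m x) ∂μ := by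
    have hc : ENNReal.ofReal M = ∫⁻ _, ENNReal.ofReal M ∂μ := by simp
    conv_lhs => rw [hc]
    rw [← lintegral_add_left hm, ← lintegral_add_right _ measurable_const, ← hc]
    refine lintegral_congr fun x => ?_
    rw [tsub_add_eq_max, add_tsub_eq_max]
  have h2 : ∫⁻ x, (ENNReal.ofReal M - m x) ∂μ ≤ ENNReal.ofReal M := by
    calc _ ≤ ∫⁻ _, ENNReal.ofReal M ∂μ := lintegral_mono fun x => tsub_le_self
      _ = _ := by simp
  simp only [eInt, erealToENN_coe_sub _ hM, erealToENN_neg_coe_sub]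
  generalize ∫⁻ x, (m x - ENNReal.ofReal M) ∂μ = a at *
  generalize ∫⁻ x, (ENNReal.ofReal M - m x) ∂μ = b at *
  generalize ∫⁻ x, m x ∂μ = I at *
  lift b to NNReal using ne_top_of_le_ne_top ENNReal.ofReal_ne_top h2
  induction a with
  | top =>
    have : I = ⊤ := by simpa using h1.symm
    rw [this]
    rfl
  | coe a =>
    have hI : I ≠ ⊤ := by
      rintro rfl
      simp at h1
    lift I to NNReal using hI
    have h3 := congrArg ENNReal.toReal h1
    rw [ENNReal.toReal_add ENNReal.coe_ne_top ENNReal.ofReal_ne_top,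
      ENNReal.toReal_add ENNReal.coe_ne_top ENNReal.coe_ne_top, ENNReal.toReal_ofReal hM] at h3
    simp only [ENNReal.coe_toReal] at h3
    change (((a : ℝ) - (b : ℝ) : ℝ) : EReal) = (((I : ℝ) - M : ℝ) : EReal)
    congr 1
    linarith

end Extended

section Conjugate

variable {X Y : Type*} [TopologicalSpace X] [MeasurableSpace X] [BorelSpace X]
  [MetricSpace Y] [CompactSpace Y] [MeasurableSpace Y] [BorelSpace Y] [Nonempty Y]
  {E : SemiStableCone Y} {C : X → Measure Y → ℝ≥0∞}

lemma lowerSemicontinuous_shifted_cost {X : Type*} [TopologicalSpace X]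
    {C : X → Measure Y → ℝ≥0∞}
    (hlsc : LowerSemicontinuous fun q : X × ProbabilityMeasure Y => C q.1 q.2.1)
    {φ : Y → ℝ} (hφ : φ ∈ E.carrier) (M : ℝ) :
    LowerSemicontinuous fun q : X × ProbabilityMeasure Y =>
      ENNReal.ofReal (∫ y, φ y ∂(q.2 : Measure Y) + M) + C q.1 q.2.1 := by
  refine LowerSemicontinuous.add ?_ hlsc
  have h1 : Continuous fun r : ℝ => ENNReal.ofReal (r + M) :=
    ENNReal.continuous_ofReal.comp (continuous_add_const M)
  exact (h1.comp_lowerSemicontinuous (lowerSemicontinuous_integral E hφ)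
    fun r r' h => ENNReal.ofReal_le_ofReal (by linarith)).comp continuous_snd

lemma abs_integral_le_of_forall {Y : Type*} [MeasurableSpace Y] {φ : Y → ℝ} {M : ℝ}
    (hM : ∀ y, |φ y| ≤ M) (ρ : Measure Y)
    [IsProbabilityMeasure ρ] : |∫ y, φ y ∂ρ| ≤ M := by
  simpa using norm_integral_le_of_norm_le_const (μ := ρ) (f := φ) (ae_of_all _ hM)

lemma exists_measurable_conjP_eq
    (hlsc : LowerSemicontinuous fun q : X × ProbabilityMeasure Y => C q.1 q.2.1)
    {φ : Y → ℝ} (hφ : φ ∈ E.carrier) {M : ℝ} (hM : ∀ y, |φ y| ≤ M) :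
    ∃ s : X → ProbabilityMeasure Y, Measurable s ∧ ∀ x, conjP C φ x =
      ((∫ y, φ y ∂(s x : Measure Y) : ℝ) : EReal) + (C x (s x : Measure Y) : EReal) := by
  have : Nonempty (ProbabilityMeasure Y) :=
    ⟨⟨Measure.dirac (Classical.arbitrary Y), inferInstance⟩⟩
  obtain ⟨s, hs, hmin⟩ := exists_measurable_argmin (lowerSemicontinuous_shifted_cost hlsc hφ M)
  have hpos (ρ : ProbabilityMeasure Y) : 0 ≤ ∫ y, φ y ∂(ρ : Measure Y) + M := by
    linarith [(abs_le.1 (abs_integral_le_of_forall hM (ρ : Measure Y))).1]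
  refine ⟨s, hs, fun x => le_antisymm (iInf_le _ (s x)) (le_iInf fun ρ => ?_)⟩
  refine (coe_ofReal_add_sub (hpos (s x)) _).symm.le.trans (le_trans ?_
    (coe_ofReal_add_sub (hpos ρ) _).le)
  exact EReal.sub_le_sub (EReal.coe_ennreal_le_coe_ennreal_iff.2 (hmin x ρ)) le_rfl

lemma eInt_conjP_le (μ : Measure X) [IsProbabilityMeasure μ]
    (hlsc : LowerSemicontinuous fun q : X × ProbabilityMeasure Y => C q.1 q.2.1)
    {φ : Y → ℝ} (hφ : φ ∈ E.carrier) {r : X → ℝ} (hr : Integrable r μ) {D : X → ℝ≥0∞}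
    {M : ℝ} (hφM : ∀ y, |φ y| ≤ M) (hM : ∀ x, |r x| ≤ M)
    (hle : ∀ x, conjP C φ x ≤ (r x : EReal) + (D x : EReal)) :
    eInt μ (conjP C φ) ≤ ((∫ x, r x ∂μ : ℝ) : EReal) + ((∫⁻ x, D x ∂μ : ℝ≥0∞) : EReal) := by
  have hM0 : 0 ≤ M := (abs_nonneg _).trans (hφM (Classical.arbitrary Y))
  obtain ⟨s, hs, hconj⟩ := exists_measurable_conjP_eq hlsc hφ hφM
  have hpos (ρ : ProbabilityMeasure Y) : 0 ≤ ∫ y, φ y ∂(ρ : Measure Y) + M := by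
    linarith [(abs_le.1 (abs_integral_le_of_forall hφM (ρ : Measure Y))).1]
  have hrpos (x) : 0 ≤ r x + M := by linarith [(abs_le.1 (hM x)).1]
  let m : X → ℝ≥0∞ := fun x =>
    ENNReal.ofReal (∫ y, φ y ∂(s x : Measure Y) + M) + C x (s x : Measure Y)
  have hm : Measurable m :=
    (lowerSemicontinuous_shifted_cost hlsc hφ M).measurable.comp (measurable_id.prodMk hs)
  have hconj' : conjP C φ = fun x => (m x : EReal) - (M : EReal) := by
    ext x
    rw [hconj, coe_ofReal_add_sub (hpos _)]
  have hm_le (x) : m x ≤ ENNReal.ofReal (r x + M) + D x := by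
    have h := hle x
    rw [hconj', ← coe_ofReal_add_sub (hrpos x)] at h
    have h' := add_le_add_left h (M : EReal)
    rwa [EReal.sub_add_cancel, EReal.sub_add_cancel, EReal.coe_ennreal_le_coe_ennreal_iff] at h'
  have hrM : Integrable (fun x => r x + M) μ := hr.add (integrable_const M)
  have hint : ∫⁻ x, m x ∂μ ≤ ENNReal.ofReal (∫ x, r x ∂μ + M) + ∫⁻ x, D x ∂μ := by
    refine (lintegral_mono hm_le).trans ?_
    rw [lintegral_add_left' hrM.aemeasurable.ennreal_ofReal,
      ← ofReal_integral_eq_lintegral_ofReal hrM (ae_of_all _ hrpos),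
      integral_add hr (integrable_const M)]
    simp
  have hint0 : 0 ≤ ∫ x, r x ∂μ + M := by
    have := integral_nonneg_of_ae (μ := μ) (ae_of_all _ hrpos)
    rw [integral_add hr (integrable_const M)] at this
    simpa using this
  rw [hconj', eInt_coe_sub μ hm hM0, ← coe_ofReal_add_sub hint0]
  exact EReal.sub_le_sub (EReal.coe_ennreal_le_coe_ennreal_iff.2 hint) le_rfl

end Conjugate

open ProbabilityTheory

section Coupling

variable {X Y : Type*} [MeasurableSpace X] [MeasurableSpace Y] {μ : Measure X}

lemma isCoupling_compProd [IsProbabilityMeasure μ] (κ : Kernel X Y) [IsMarkovKernel κ] :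
    IsCoupling (μ ⊗ₘ κ) μ ((μ ⊗ₘ κ).map Prod.snd) :=
  ⟨inferInstance, Measure.fst_compProd μ κ, rfl⟩

variable [StandardBorelSpace Y] [Nonempty Y]

lemma disint_eq_condKernel (π : Measure (X × Y)) [IsFiniteMeasure π] :
    disint π = π.condKernel := by
  rw [disint, dif_pos]

lemma disint_compProd_ae_eq [IsProbabilityMeasure μ] (κ : Kernel X Y) [IsMarkovKernel κ] :
    ∀ᵐ x ∂μ, disint (μ ⊗ₘ κ) x = κ x := by
  have h := eq_condKernel_of_measure_eq_compProd (ρ := μ ⊗ₘ κ) κ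
    (by rw [Measure.fst_compProd])
  rw [Measure.fst_compProd] at h
  filter_upwards [h] with x hx
  rw [disint_eq_condKernel, hx]

instance (π : Measure (X × Y)) [IsFiniteMeasure π] : IsMarkovKernel (disint π) := by
  rw [disint_eq_condKernel]
  infer_instance

lemma compProd_disint_of_isCoupling {π : Measure (X × Y)} {η : Measure Y} (h : IsCoupling π μ η) :
    μ ⊗ₘ disint π = π := by
  have := h.1
  rw [disint_eq_condKernel, ← h.2.1]
  exact π.disintegrate π.condKernel

end Coupling

section Averaging

variable {X Y : Type*} [MeasurableSpace X] [TopologicalSpace Y] [MeasurableSpace Y] [BorelSpace Y]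
  {E : SemiStableCone Y} {μ : Measure X} [IsProbabilityMeasure μ]
  {κ : Kernel X Y} [IsMarkovKernel κ] {φ : Y → ℝ}

lemma measurable_of_mem_carrier (hφ : φ ∈ E.carrier) : Measurable φ :=
  (E.subset_lsc_bdd φ hφ).1.measurable

lemma integrable_integral_kernel (hφ : φ ∈ E.carrier) :
    Integrable (fun x => ∫ y, φ y ∂κ x) μ := by
  obtain ⟨M, hM⟩ := (E.subset_lsc_bdd φ hφ).2
  refine Integrable.of_bound ?_ M (ae_of_all _ fun x => abs_integral_le_of_forall hM (κ x))
  exact (measurable_of_mem_carrier hφ).stronglyMeasurable.integral_kernel.aestronglyMeasurable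

lemma integral_snd_compProd (hφ : φ ∈ E.carrier) :
    ∫ y, φ y ∂((μ ⊗ₘ κ).map Prod.snd) = ∫ x, ∫ y, φ y ∂κ x ∂μ := by
  have hm := measurable_of_mem_carrier hφ
  obtain ⟨M, hM⟩ := (E.subset_lsc_bdd φ hφ).2
  rw [integral_map measurable_snd.aemeasurable hm.aestronglyMeasurable,
    Measure.integral_compProd]
  exact Integrable.of_bound (hm.comp measurable_snd).aestronglyMeasurable M
    (ae_of_all _ fun x => hM _)

lemma integral_eq_of_isCoupling [StandardBorelSpace Y] [Nonempty Y] {π : Measure (X × Y)}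
    {η : Measure Y} (h : IsCoupling π μ η) (hφ : φ ∈ E.carrier) :
    ∫ y, φ y ∂η = ∫ x, ∫ y, φ y ∂disint π x ∂μ := by
  have := h.1
  rw [← integral_snd_compProd hφ, compProd_disint_of_isCoupling h, h.2.2]

end Averaging

section OrderCost

variable {X Y : Type*} [TopologicalSpace Y] [MeasurableSpace Y]
  {E : SemiStableCone Y} {C : X → Measure Y → ℝ≥0∞}

/-- The least cost of a measure dominated by `ρ` in the order of the cone. -/
def orderCost (E : SemiStableCone Y) (C : X → Measure Y → ℝ≥0∞) (x : X) (ρ : Measure Y) : ℝ≥0∞ :=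
  ⨅ ξ : {ξ : Measure Y // IsProbabilityMeasure ξ ∧ EOrder E.carrier ξ ρ}, C x ξ.1

lemma conjP_le_add_orderCost [MeasurableSpace X] {φ : Y → ℝ} (hφ : φ ∈ E.carrier) (x : X)
    (ρ : Measure Y)
    [IsProbabilityMeasure ρ] :
    conjP C φ x ≤ ((∫ y, φ y ∂ρ : ℝ) : EReal) + (orderCost E C x ρ : EReal) := by
  obtain ⟨M, hM⟩ := (E.subset_lsc_bdd φ hφ).2
  have hpos : 0 ≤ ∫ y, φ y ∂ρ + M := by
    linarith [(abs_le.1 (abs_integral_le_of_forall hM ρ)).1]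
  have : Nonempty {ξ : Measure Y // IsProbabilityMeasure ξ ∧ EOrder E.carrier ξ ρ} :=
    ⟨ρ, inferInstance, fun f _ => le_rfl⟩
  by_cases htop : orderCost E C x ρ = ⊤
  · rw [htop]
    simp
  by_contra! hlt
  have hbot : (orderCost E C x ρ : EReal) < conjP C φ x - ((∫ y, φ y ∂ρ : ℝ) : EReal) :=
    EReal.lt_sub_iff_add_lt (by simp) (by simp) |>.2 (by rwa [add_comm])
  obtain ⟨c, hc1, hc2⟩ := EReal.lt_iff_exists_real_btwn.1 hbot
  have hc0 : 0 ≤ c := by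
    have := (EReal.coe_ennreal_nonneg _).trans hc1.le
    exact_mod_cast this
  have hc1' : orderCost E C x ρ < ENNReal.ofReal c := by
    rw [← EReal.coe_ennreal_lt_coe_ennreal_iff, EReal.coe_ennreal_ofReal, max_eq_left hc0]
    exact hc1
  obtain ⟨ξ, hξ⟩ := iInf_lt_iff.1 hc1'
  have := ξ.2.1
  have h1 : conjP C φ x ≤ ((∫ y, φ y ∂ξ.1 : ℝ) : EReal) + (C x ξ.1 : EReal) :=
    iInf_le (fun ρ : {ρ : Measure Y // IsProbabilityMeasure ρ} =>
      ((∫ y, φ y ∂ρ.1 : ℝ) : EReal) + ((C x ρ.1 : ℝ≥0∞) : EReal)) ⟨ξ.1, ξ.2.1⟩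
  have h2 : (C x ξ.1 : EReal) ≤ (c : EReal) := by
    rw [← max_eq_left hc0, ← EReal.coe_ennreal_ofReal, EReal.coe_ennreal_le_coe_ennreal_iff]
    exact hξ.le
  have h3 : ((∫ y, φ y ∂ξ.1 : ℝ) : EReal) ≤ ((∫ y, φ y ∂ρ : ℝ) : EReal) :=
    EReal.coe_le_coe_iff.2 (ξ.2.2 φ hφ)
  have h4 := h1.trans (add_le_add h3 h2)
  refine absurd hc2 (not_lt.2 ?_)
  rw [EReal.sub_le_iff_le_add (by simp) (by simp), add_comm]
  exact h4

lemma orderCost_le (x : X) (ρ : Measure Y) [IsProbabilityMeasure ρ] : orderCost E C x ρ ≤ C x ρ :=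
  iInf_le (fun ξ : {ξ : Measure Y // IsProbabilityMeasure ξ ∧ EOrder E.carrier ξ ρ} => C x ξ.1)
    ⟨ρ, inferInstance, fun _ _ => le_rfl⟩

end OrderCost

section WeakDuality

variable {X Y : Type*} [TopologicalSpace X] [MeasurableSpace X] [BorelSpace X]
  [MetricSpace Y] [CompactSpace Y] [PolishSpace Y] [MeasurableSpace Y] [BorelSpace Y] [Nonempty Y]
  {E : SemiStableCone Y} {C : X → Measure Y → ℝ≥0∞} {μ : Measure X} [IsProbabilityMeasure μ]
  {ν : Measure Y}

/-- The value of the dual problem. -/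
def dualValue (E : SemiStableCone Y) (C : X → Measure Y → ℝ≥0∞) (μ : Measure X) (ν : Measure Y) :
    EReal :=
  ⨆ ψ : {ψ : Y → ℝ // ψ ∈ E.carrier}, eInt μ (conjP C ψ.1) - ((∫ y, ψ.1 y ∂ν : ℝ) : EReal)

lemma dualValue_le_lintegral_orderCost
    (hlsc : LowerSemicontinuous fun q : X × ProbabilityMeasure Y => C q.1 q.2.1)
    {π : Measure (X × Y)} {η : Measure Y} (h : IsCoupling π μ η) (hη : EOrder E.carrier η ν) :
    dualValue E C μ ν ≤ ((∫⁻ x, orderCost E C x (disint π x) ∂μ : ℝ≥0∞) : EReal) := by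
  have := h.1
  refine iSup_le fun ⟨φ, hφ⟩ => ?_
  obtain ⟨M, hM⟩ := (E.subset_lsc_bdd φ hφ).2
  rw [EReal.sub_le_iff_le_add (by simp) (by simp), add_comm]
  refine (eInt_conjP_le μ hlsc hφ (integrable_integral_kernel hφ) hM
    (fun x => abs_integral_le_of_forall hM (disint π x))
    fun x => conjP_le_add_orderCost hφ x (disint π x)).trans ?_
  gcongr
  rw [← integral_eq_of_isCoupling h hφ]
  exact hη φ hφ

end WeakDuality

open ProbabilityTheory

section GraphCost

variable {X Y : Type*} [MetricSpace Y] [MeasurableSpace Y] {E : SemiStableCone Y}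
  {C : X → Measure Y → ℝ≥0∞}

open scoped Classical in
/-- The cost of the first component of a pair, restricted to pairs that are ordered. -/
def graphCost (E : SemiStableCone Y) (C : X → Measure Y → ℝ≥0∞)
    (q : X × (ProbabilityMeasure Y × ProbabilityMeasure Y)) : ℝ≥0∞ :=
  if EOrder E.carrier (q.2.1 : Measure Y) (q.2.2 : Measure Y) then C q.1 q.2.1 else ⊤

lemma lowerSemicontinuous_graphCost [TopologicalSpace X] [CompactSpace Y] [BorelSpace Y]
    [Nonempty Y]
    (hlsc : LowerSemicontinuous fun q : X × ProbabilityMeasure Y => C q.1 q.2.1) :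
    LowerSemicontinuous (graphCost E C) := by
  intro q a ha
  by_cases hq : EOrder E.carrier (q.2.1 : Measure Y) (q.2.2 : Measure Y)
  · rw [graphCost, if_pos hq] at ha
    have hc : Continuous fun q : X × (ProbabilityMeasure Y × ProbabilityMeasure Y) =>
      (q.1, q.2.1) := by fun_prop
    filter_upwards [hc.continuousAt.eventually (hlsc (q.1, q.2.1) a ha)] with q' hq'
    rw [graphCost]
    split_ifs
    · exact hq'
    · exact lt_top_of_lt ha
  · have ha' : a < ⊤ := by rwa [graphCost, if_neg hq] at ha
    filter_upwards [((isClosed_eOrder E).preimage continuous_snd).isOpen_compl.mem_nhds hq]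
      with q' hq'
    have hq'' : ¬EOrder E.carrier (q'.2.1 : Measure Y) (q'.2.2 : Measure Y) := hq'
    rw [graphCost, if_neg hq'']
    exact ha'

lemma convexCost_graphCost [BorelSpace Y]
    (hconv : ∀ x : X, ∀ ρ₁ ρ₂ : Measure Y, IsProbabilityMeasure ρ₁ →
      IsProbabilityMeasure ρ₂ → ∀ t : ℝ≥0∞, t ≤ 1 →
      C x (t • ρ₁ + (1 - t) • ρ₂) ≤ t * C x ρ₁ + (1 - t) * C x ρ₂) :
    ConvexCost (graphCost E C) := by
  intro t ht x z w
  rcases eq_or_ne t 0 with rfl | h0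
  · have : mixPair 0 ht z w = w := by
      ext1 <;> apply ProbabilityMeasure.toMeasure_injective <;> simp [mixPair, mix]
    simp [this]
  rcases eq_or_ne t 1 with rfl | h1
  · have : mixPair 1 ht z w = z := by
      ext1 <;> apply ProbabilityMeasure.toMeasure_injective <;> simp [mixPair, mix]
    simp [this]
  by_cases hz : EOrder E.carrier (z.1 : Measure Y) (z.2 : Measure Y)
  swap
  · simp [graphCost, hz, ENNReal.mul_top h0]
  by_cases hw : EOrder E.carrier (w.1 : Measure Y) (w.2 : Measure Y)
  swap
  · have : 1 - t ≠ 0 := (tsub_pos_of_lt (lt_of_le_of_ne ht h1)).ne'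
    simp [graphCost, hw, ENNReal.mul_top this]
  have hm : EOrder E.carrier ((mixPair t ht z w).1 : Measure Y)
      ((mixPair t ht z w).2 : Measure Y) := by
    intro f hf
    change ∫ y, f y ∂(mix t ht z.1 w.1 : Measure Y) ≤ ∫ y, f y ∂(mix t ht z.2 w.2 : Measure Y)
    have hi (ρ : ProbabilityMeasure Y) := integrable_of_mem_carrier E hf (ρ : Measure Y)
    rw [integral_mix ht _ _ (hi _) (hi _), integral_mix ht _ _ (hi _) (hi _)]
    have h1 : t.toReal ≤ 1 := ENNReal.toReal_mono ENNReal.one_ne_top ht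
    exact add_le_add (mul_le_mul_of_nonneg_left (hz f hf) ENNReal.toReal_nonneg)
      (mul_le_mul_of_nonneg_left (hw f hf) (by linarith))
  rw [graphCost, graphCost, graphCost, if_pos hm, if_pos hz, if_pos hw]
  exact hconv x _ _ inferInstance inferInstance t ht

lemma eOrder_of_graphCost_lt_top {x : X} {z : ProbabilityMeasure Y × ProbabilityMeasure Y}
    (h : graphCost E C (x, z) < ⊤) :
    EOrder E.carrier (z.1 : Measure Y) (z.2 : Measure Y) ∧ graphCost E C (x, z) = C x z.1 := by
  by_cases hz : EOrder E.carrier (z.1 : Measure Y) (z.2 : Measure Y)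
  · exact ⟨hz, if_pos hz⟩
  · rw [graphCost, if_neg hz] at h
    exact absurd h (lt_irrefl _)

end GraphCost

section Primal

variable {X Y : Type*} [MeasurableSpace X] [MetricSpace Y] [CompactSpace Y]
  [MeasurableSpace Y] [BorelSpace Y] {μ : Measure X}

/-- The kernel given by a measurable map into the probability measures. -/
def kernelOfMap {κ : X → ProbabilityMeasure Y} (hκ : Measurable κ) : Kernel X Y where
  toFun x := κ x
  measurable' := measurable_subtype_coe.comp hκ

instance {κ : X → ProbabilityMeasure Y} (hκ : Measurable κ) : IsMarkovKernel (kernelOfMap hκ) :=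
  ⟨fun x => (κ x).2⟩

lemma integral_snd_compProd_continuousMap [IsProbabilityMeasure μ] (κ : Kernel X Y)
    [IsMarkovKernel κ] (f : C(Y, ℝ)) :
    ∫ y, f y ∂((μ ⊗ₘ κ).map Prod.snd) = ∫ x, ∫ y, f y ∂κ x ∂μ := by
  rw [integral_map measurable_snd.aemeasurable f.continuous.measurable.aestronglyMeasurable,
    Measure.integral_compProd]
  exact Integrable.of_bound (f.continuous.measurable.comp measurable_snd).aestronglyMeasurable ‖f‖
    (ae_of_all _ fun x => f.norm_coe_le_norm _)

lemma map_snd_compProd_eq [IsProbabilityMeasure μ] {ν : ProbabilityMeasure Y}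
    {κ : X → ProbabilityMeasure Y} (hκ : Measurable κ)
    (h : ∀ j, ∫ x, moments (κ x) j ∂μ = moments ν j) :
    (μ ⊗ₘ kernelOfMap hκ).map Prod.snd = (ν : Measure Y) := by
  have : IsProbabilityMeasure ((μ ⊗ₘ kernelOfMap hκ).map Prod.snd) :=
    Measure.isProbabilityMeasure_map measurable_snd.aemeasurable
  refine congrArg Subtype.val (a₁ := (⟨_, this⟩ : ProbabilityMeasure Y)) (injective_moments ?_)
  ext j
  rw [← h]
  exact integral_snd_compProd_continuousMap _ _

end Primal

section StrongDuality

variable {X Y : Type*} [TopologicalSpace X] [MeasurableSpace X] [BorelSpace X]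
  [MetricSpace Y] [CompactSpace Y] [MeasurableSpace Y] [BorelSpace Y] [Nonempty Y]
  {E : SemiStableCone Y} {C : X → Measure Y → ℝ≥0∞} {μ : Measure X}

lemma eInt_eq_of_forall_coe {X : Type*} [MeasurableSpace X] {μ : Measure X} {f : X → EReal}
    {m : X → ℝ≥0∞} (h : ∀ x, f x = m x) :
    eInt μ f = ((∫⁻ x, m x ∂μ : ℝ≥0∞) : EReal) := by
  have h0 (x) : erealToENN (-(m x : EReal)) = 0 :=
    erealToENN_of_nonpos (by simpa using EReal.coe_ennreal_nonneg (m x))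
  simp [eInt, h, erealToENN_coe, h0]

lemma eInt_conjP_eq
    (hlsc : LowerSemicontinuous fun q : X × ProbabilityMeasure Y => C q.1 q.2.1)
    {φ : Y → ℝ} (hφ : φ ∈ E.carrier) (hφ0 : 0 ≤ φ) :
    ∃ s : X → ProbabilityMeasure Y, eInt μ (conjP C φ) = ((∫⁻ x, (C x (s x : Measure Y) +
      ENNReal.ofReal (∫ y, φ y ∂(s x : Measure Y))) ∂μ : ℝ≥0∞) : EReal) := by
  obtain ⟨M, hM⟩ := (E.subset_lsc_bdd φ hφ).2
  obtain ⟨s, -, hs⟩ := exists_measurable_conjP_eq hlsc hφ hM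
  refine ⟨s, eInt_eq_of_forall_coe fun x => ?_⟩
  rw [hs, EReal.coe_ennreal_add, EReal.coe_ennreal_ofReal, max_eq_left (integral_nonneg hφ0),
    add_comm]

lemma dualValue_nonneg
    (hlsc : LowerSemicontinuous fun q : X × ProbabilityMeasure Y => C q.1 q.2.1)
    (ν : Measure Y) : 0 ≤ dualValue E C μ ν := by
  have h0 := E.const_mem 0
  obtain ⟨s, hs⟩ := eInt_conjP_eq (μ := μ) hlsc h0 (fun _ => le_rfl)
  refine le_trans ?_ (le_iSup (fun ψ : {ψ : Y → ℝ // ψ ∈ E.carrier} =>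
    eInt μ (conjP C ψ.1) - ((∫ y, ψ.1 y ∂ν : ℝ) : EReal)) ⟨_, h0⟩)
  simp only [hs, integral_zero, EReal.coe_zero, sub_zero]
  exact EReal.coe_ennreal_nonneg _

lemma lintegral_iInf_graphCost_le
    (hlsc : LowerSemicontinuous fun q : X × ProbabilityMeasure Y => C q.1 q.2.1)
    (ν : ProbabilityMeasure Y) {S : ℝ} (hS : 0 ≤ S)
    (h : dualValue E C μ ν ≤ (S : EReal)) {ψ : C(Y, ℝ)} (hψ : 0 ≤ ψ) :
    ∫⁻ x, ⨅ z : ProbabilityMeasure Y × ProbabilityMeasure Y,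
      (graphCost E C (x, z) + ENNReal.ofReal (integralLin z.2 ψ)) ∂μ ≤
        ENNReal.ofReal S + ENNReal.ofReal (integralLin ν ψ) := by
  have hφ := env_mem E ψ
  have hφ0 : 0 ≤ env E ψ := le_env E (E.const_mem 0) hψ
  obtain ⟨s, hs⟩ := eInt_conjP_eq (μ := μ) hlsc hφ hφ0
  have h1 := (le_iSup (fun ψ : {ψ : Y → ℝ // ψ ∈ E.carrier} =>
    eInt μ (conjP C ψ.1) - ((∫ y, ψ.1 y ∂(ν : Measure Y) : ℝ) : EReal)) ⟨_, hφ⟩).trans h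
  simp only [hs] at h1
  rw [EReal.sub_le_iff_le_add (by simp) (by simp), ← max_eq_left hS,
    ← max_eq_left (integral_nonneg (μ := (ν : Measure Y)) hφ0), ← EReal.coe_ennreal_ofReal,
    ← EReal.coe_ennreal_ofReal, ← EReal.coe_ennreal_add,
    EReal.coe_ennreal_le_coe_ennreal_iff] at h1
  refine (lintegral_mono fun x => ?_).trans (h1.trans ?_)
  · obtain ⟨ρ, hρ, hle, hint⟩ := exists_eOrder_integral_le_env E ψ (s x : Measure Y)
    refine (iInf_le _ (s x, ⟨ρ, hρ⟩)).trans ?_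
    exact add_le_add (if_pos hle).le (ENNReal.ofReal_le_ofReal hint)
  · exact add_le_add le_rfl (ENNReal.ofReal_le_ofReal
      (integral_mono (integrable_of_mem_carrier E hφ _) (integrable_continuousMap ψ _)
        (env_le E ψ)))

/-- If the dual value is at most `S`, both primal problems admit competitors of cost at most
`S`. -/
lemma exists_couplings_le [StandardBorelSpace Y] [IsProbabilityMeasure μ]
    (hlsc : LowerSemicontinuous fun q : X × ProbabilityMeasure Y => C q.1 q.2.1)
    (hconv : ∀ x : X, ∀ ρ₁ ρ₂ : Measure Y, IsProbabilityMeasure ρ₁ →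
      IsProbabilityMeasure ρ₂ → ∀ t : ℝ≥0∞, t ≤ 1 →
      C x (t • ρ₁ + (1 - t) • ρ₂) ≤ t * C x ρ₁ + (1 - t) * C x ρ₂)
    (ν : ProbabilityMeasure Y) {S : ℝ} (hS : 0 ≤ S) (h : dualValue E C μ ν ≤ (S : EReal)) :
    (∃ η : Measure Y, IsProbabilityMeasure η ∧ EOrder E.carrier η (ν : Measure Y) ∧
      ∃ π : Measure (X × Y), IsCoupling π μ η ∧
        ∫⁻ x, C x (disint π x) ∂μ ≤ ENNReal.ofReal S) ∧
    ∃ π : Measure (X × Y), IsCoupling π μ (ν : Measure Y) ∧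
      ∫⁻ x, orderCost E C x (disint π x) ∂μ ≤ ENNReal.ofReal S := by
  have hg := lowerSemicontinuous_graphCost (E := E) hlsc
  obtain ⟨s, hs, hle, hmom⟩ := exists_minimising_map hg (convexCost_graphCost hconv) μ ν hS
    fun ψ hψ => lintegral_iInf_graphCost_le hlsc ν hS h hψ
  have hs1 : Measurable fun x => (s x).1 := measurable_fst.comp hs
  have hs2 : Measurable fun x => (s x).2 := measurable_snd.comp hs
  have hlt : ∀ᵐ x ∂μ, graphCost E C (x, s x) < ⊤ :=
    ae_lt_top (measurable_comp_graph hg hs) (hle.trans_lt ENNReal.ofReal_lt_top).ne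
  have hν := map_snd_compProd_eq hs2 hmom
  have hd1 := disint_compProd_ae_eq (μ := μ) (kernelOfMap hs1)
  have hd2 := disint_compProd_ae_eq (μ := μ) (kernelOfMap hs2)
  constructor
  · refine ⟨(μ ⊗ₘ kernelOfMap hs1).map Prod.snd,
      Measure.isProbabilityMeasure_map measurable_snd.aemeasurable, fun f hf => ?_,
      μ ⊗ₘ kernelOfMap hs1, isCoupling_compProd _, ?_⟩
    · rw [← hν, integral_snd_compProd hf, integral_snd_compProd hf]
      refine integral_mono_ae (integrable_integral_kernel hf) (integrable_integral_kernel hf) ?_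
      filter_upwards [hlt] with x hx
      exact (eOrder_of_graphCost_lt_top hx).1 f hf
    · refine le_trans (lintegral_mono_ae ?_) hle
      filter_upwards [hlt, hd1] with x hx hx1
      rw [hx1, (eOrder_of_graphCost_lt_top hx).2]
      rfl
  · refine ⟨μ ⊗ₘ kernelOfMap hs2, hν ▸ isCoupling_compProd _, le_trans (lintegral_mono_ae ?_) hle⟩
    filter_upwards [hlt, hd2] with x hx hx2
    rw [hx2, (eOrder_of_graphCost_lt_top hx).2]
    exact iInf_le (fun ξ : {ξ : Measure Y // IsProbabilityMeasure ξ ∧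
      EOrder E.carrier ξ (s x).2} => C x ξ.1)
      ⟨(s x).1, inferInstance, (eOrder_of_graphCost_lt_top hx).1⟩

end StrongDuality

end WeakTransport

end

/-- **Projection theorem** (Theorem 14): for a compact Polish space `Y`, a semi-stable cone
`E` on `Y` and an lsc cost `C`, convex in its second argument,
`inf_{η ≼_E ν} inf_{π ∈ Π(μ,η)} ∫ C(x,π_x) dμ = inf_{π ∈ Π(μ,ν)} ∫ inf_{ξ ≼_E π_x} C(x,ξ) dμ
  = sup_{ψ ∈ E} μ(ψ^C) - ν(ψ)`. -/
theorem projection_theorem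
    {X Y : Type*} [TopologicalSpace X] [PolishSpace X] [MeasurableSpace X] [BorelSpace X]
    [MetricSpace Y] [CompactSpace Y] [PolishSpace Y]
    [MeasurableSpace Y] [BorelSpace Y] [Nonempty Y]
    (E : SemiStableCone Y) (C : X → Measure Y → ℝ≥0∞)
    (hlsc : LowerSemicontinuous fun q : X × ProbabilityMeasure Y => C q.1 q.2.1)
    (hconv : ∀ x : X, ∀ ρ₁ ρ₂ : Measure Y, IsProbabilityMeasure ρ₁ →
      IsProbabilityMeasure ρ₂ → ∀ t : ℝ≥0∞, t ≤ 1 →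
      C x (t • ρ₁ + (1 - t) • ρ₂) ≤ t * C x ρ₁ + (1 - t) * C x ρ₂)
    (μ : Measure X) (hμ : IsProbabilityMeasure μ)
    (ν : Measure Y) (hν : IsProbabilityMeasure ν) :
    (⨅ η : {η : Measure Y // IsProbabilityMeasure η ∧ EOrder E.carrier η ν},
        ⨅ π : {π : Measure (X × Y) // IsCoupling π μ η.1},
          ∫⁻ x, C x (disint π.1 x) ∂μ)
      = (⨅ π : {π : Measure (X × Y) // IsCoupling π μ ν},
          ∫⁻ x, (⨅ ξ : {ξ : Measure Y // IsProbabilityMeasure ξ ∧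
              EOrder E.carrier ξ (disint π.1 x)}, C x ξ.1) ∂μ)
    ∧ (((⨅ π : {π : Measure (X × Y) // IsCoupling π μ ν},
          ∫⁻ x, (⨅ ξ : {ξ : Measure Y // IsProbabilityMeasure ξ ∧
              EOrder E.carrier ξ (disint π.1 x)}, C x ξ.1) ∂μ : ℝ≥0∞)) : EReal)
        = ⨆ ψ : {ψ : Y → ℝ // ψ ∈ E.carrier},
            eInt μ (conjP C ψ.1) - ((∫ y, ψ.1 y ∂ν : ℝ) : EReal) := by
  have hB (π : {π : Measure (X × Y) // IsCoupling π μ ν}) :=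
    WeakTransport.dualValue_le_lintegral_orderCost hlsc π.2 (E := E) (ν := ν) fun _ _ => le_rfl
  have hA (η : {η : Measure Y // IsProbabilityMeasure η ∧ EOrder E.carrier η ν})
      (π : {π : Measure (X × Y) // IsCoupling π μ η.1}) :
      WeakTransport.dualValue E C μ ν ≤ ((∫⁻ x, C x (disint π.1 x) ∂μ : ℝ≥0∞) : EReal) := by
    have := π.2.1
    exact (WeakTransport.dualValue_le_lintegral_orderCost hlsc π.2 η.2.2).trans
      (EReal.coe_ennreal_le_coe_ennreal_iff.2
        (lintegral_mono fun x => WeakTransport.orderCost_le x _))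
  obtain ⟨S, hS⟩ : ∃ S : ℝ≥0∞, WeakTransport.dualValue E C μ ν = (S : EReal) :=
    ⟨_, (EReal.coe_toENNReal (WeakTransport.dualValue_nonneg hlsc ν)).symm⟩
  simp only [hS, EReal.coe_ennreal_le_coe_ennreal_iff] at hA hB
  have hle : S < ⊤ → _ := fun hlt =>
    WeakTransport.exists_couplings_le (E := E) (μ := μ) hlsc hconv ⟨ν, hν⟩
      (S := S.toReal) ENNReal.toReal_nonneg (hS.le.trans_eq (EReal.coe_ennreal_toReal hlt.ne).symm)
  have hAeq : (⨅ η : {η : Measure Y // IsProbabilityMeasure η ∧ EOrder E.carrier η ν},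
      ⨅ π : {π : Measure (X × Y) // IsCoupling π μ η.1}, ∫⁻ x, C x (disint π.1 x) ∂μ) = S := by
    refine le_antisymm ?_ (le_iInf fun η => le_iInf fun π => hA η π)
    rcases eq_top_or_lt_top S with htop | hlt
    · exact htop ▸ le_top
    obtain ⟨⟨η, hη, hην, π, hπ, h⟩, -⟩ := hle hlt
    rw [ENNReal.ofReal_toReal hlt.ne] at h
    exact (iInf₂_le (⟨η, hη, hην⟩ : {η : Measure Y // IsProbabilityMeasure η ∧
      EOrder E.carrier η ν}) ⟨π, hπ⟩).trans h
  have hBeq : (⨅ π : {π : Measure (X × Y) // IsCoupling π μ ν},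
      ∫⁻ x, WeakTransport.orderCost E C x (disint π.1 x) ∂μ) = S := by
    refine le_antisymm ?_ (le_iInf hB)
    rcases eq_top_or_lt_top S with htop | hlt
    · exact htop ▸ le_top
    obtain ⟨-, π, hπ, h⟩ := hle hlt
    rw [ENNReal.ofReal_toReal hlt.ne] at h
    exact (iInf_le _ (⟨π, hπ⟩ : {π : Measure (X × Y) // IsCoupling π μ ν})).trans h
  exact ⟨hAeq.trans hBeq.symm, (congrArg _ hBeq).trans hS.symm⟩
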